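/- arXiv:1808.04652 — 2 statements merged into one kernel-verified Lean document; each statement's English description precedes it below -/
import Mathlib

section
/- Let $R = k[x_1,\ldots,x_d]$ with maximal ideal $\mathfrak{m} = (x_1,\ldots,x_d)$, and let $I$ be a squarefree monomial ideal. Then for every $j$ and every $q > 1$, there is an injection $\operatorname{Ext}^j_R(R/I, R) \hookrightarrow \operatorname{Ext}^j_R(R/I^{[q]}, R)$, and moreover $\operatorname{F}_q(\operatorname{Ext}^j_R(R/I, R)) \cong \operatorname{Ext}^j_R(R/I^{[q]}, R)$. -/
open MvPolynomial CategoryTheory Opposite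

/-- The Ext module `Ext^i_R(M, N)`. -/
noncomputable abbrev ExtMod (R : Type) [CommRing R] (i : ℕ) (M N : ModuleCat R) :
    ModuleCat R :=
  ((Ext R (ModuleCat R) i).obj (op M)).obj N

section Presentations

variable {R R' : Type*} [CommRing R] [CommRing R'] {Z E Z' E' : Type*}
  [AddCommGroup Z] [AddCommGroup E] [AddCommGroup Z'] [AddCommGroup E']

theorem exists_injective_of_presentation [Module R Z] [Module R E] [Module R Z'] [Module R E']
    (π : Z →ₗ[R] E) (hπ : Function.Surjective π) (π' : Z' →ₗ[R] E')
    (a : Z →ₗ[R] Z') (ha : ∀ z, π' (a z) = 0 ↔ π z = 0) :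
    ∃ f : E →ₗ[R] E', Function.Injective f := by
  have hker : LinearMap.ker π = LinearMap.ker (π' ∘ₗ a) := by
    ext z
    simp [ha]
  refine ⟨(LinearMap.ker π).liftQ (π' ∘ₗ a) hker.le ∘ₗ
    (π.quotKerEquivOfSurjective hπ).symm.toLinearMap, ?_⟩
  rw [LinearMap.coe_comp]
  refine Function.Injective.comp ?_ (LinearEquiv.injective _)
  rw [← LinearMap.ker_eq_bot, Submodule.ker_liftQ_eq_bot _ _ _ hker.ge]

theorem exists_semilinear_baseChange_of_presentation [Module R Z] [Module R E] [Module R' Z']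
    [Module R' E'] (φ : R →+* R') {κ : Type*} [Fintype κ] (b : κ → R') (θ : κ → R' →+ R)
    (hb : ∀ r, ∑ c, b c * φ (θ c r) = r)
    (π : Z →ₗ[R] E) (hπ : Function.Surjective π)
    (π' : Z' →ₗ[R'] E') (hπ' : Function.Surjective π')
    (G : Z →ₛₗ[φ] Z') (hG : ∀ z, π z = 0 → π' (G z) = 0)
    (Θ : κ → Z' →+ Z) (hΘ : ∀ c z, π' z = 0 → π (Θ c z) = 0)
    (hΘG : ∀ c r z, Θ c (r • G z) = θ c r • z)
    (hGΘ : ∀ z, ∑ c, b c • G (Θ c z) = z) :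
    ∃ g : E →ₛₗ[φ] E', ∀ (P : Type) [AddCommGroup P] [Module R' P] (f : E →ₛₗ[φ] P),
      ∃! h : E' →ₗ[R'] P, ∀ x, h (g x) = f x := by
  have hker : LinearMap.ker π ≤ LinearMap.ker (π'.comp G) := fun z hz => by
    simpa using hG z hz
  let g : E →ₛₗ[φ] E' := ((LinearMap.ker π).liftQ (π'.comp G) hker).comp
    (π.quotKerEquivOfSurjective hπ).symm.toLinearMap
  have hg : ∀ z, g (π z) = π' (G z) := fun z => by
    have : (π.quotKerEquivOfSurjective hπ).symm (π z) = Submodule.Quotient.mk z := by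
      rw [LinearEquiv.symm_apply_eq]
      rfl
    simp only [g, LinearMap.comp_apply, LinearEquiv.coe_coe, this]
    rfl
  refine ⟨g, fun P _ _ f => ?_⟩
  let H : Z' →+ P :=
    { toFun := fun z => ∑ c, b c • f (π (Θ c z))
      map_zero' := by simp
      map_add' := fun x y => by simp [Finset.sum_add_distrib] }
  have hH : ∀ z, H z = ∑ c, b c • f (π (Θ c z)) := fun _ => rfl
  have hHG : ∀ (r : R') (z : Z), H (r • G z) = r • f (π z) := fun r z => by
    simp only [hH, hΘG, map_smul, LinearMap.map_smulₛₗ, smul_smul]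
    rw [← Finset.sum_smul, hb]
  let L : Z' →ₗ[R'] P :=
    { toFun := H
      map_add' := H.map_add
      map_smul' := fun r z => by
        conv_lhs => rw [← hGΘ z]
        conv_rhs => rw [← hGΘ z]
        simp only [Finset.smul_sum, smul_smul, map_sum, hHG, RingHom.id_apply] }
  have hL : ∀ z, L z = ∑ c, b c • f (π (Θ c z)) := fun _ => rfl
  have hker' : LinearMap.ker π' ≤ LinearMap.ker L := fun z hz => by
    rw [LinearMap.mem_ker, hL]
    exact Finset.sum_eq_zero fun c _ => by rw [hΘ c z hz, map_zero, smul_zero]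
  refine ⟨(LinearMap.ker π').liftQ L hker' ∘ₗ
    (π'.quotKerEquivOfSurjective hπ').symm.toLinearMap, ?_, ?_⟩
  · intro x
    obtain ⟨z, rfl⟩ := hπ x
    have : (π'.quotKerEquivOfSurjective hπ').symm (π' (G z)) = Submodule.Quotient.mk (G z) := by
      rw [LinearEquiv.symm_apply_eq]
      rfl
    simp only [LinearMap.comp_apply, LinearEquiv.coe_coe, hg, this]
    have h1 := hHG 1 z
    rw [one_smul, one_smul] at h1
    exact h1
  · intro h hh
    ext x
    obtain ⟨z, rfl⟩ := hπ' x
    have : (π'.quotKerEquivOfSurjective hπ').symm (π' z) = Submodule.Quotient.mk z := by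
      rw [LinearEquiv.symm_apply_eq]
      rfl
    simp only [LinearMap.comp_apply, LinearEquiv.coe_coe, this]
    change h (π' z) = L z
    conv_lhs => rw [← hGΘ z]
    simp only [map_sum, map_smul, ← hg, hh, hL]

end Presentations

section AlternatingSums

variable {ι A B : Type*} [AddCommGroup A] [AddCommGroup B]

/-- The alternating sum of the values of `u` on the faces of the tuple `s`. -/
def alternatingFaceSum {n : ℕ} (u : (Fin n → ι) → A) (s : Fin (n + 1) → ι) : A :=
  ∑ j : Fin (n + 1), (-1 : ℤ) ^ (j : ℕ) • u (j.removeNth s)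

theorem map_alternatingFaceSum {F : Type*} [FunLike F A B] [AddMonoidHomClass F A B] (f : F)
    {n : ℕ} (u : (Fin n → ι) → A) (s : Fin (n + 1) → ι) :
    f (alternatingFaceSum u s) = alternatingFaceSum (fun t => f (u t)) s := by
  simp [alternatingFaceSum, map_sum, map_zsmul]

theorem alternatingFaceSum_congr {n : ℕ} {u v : (Fin n → ι) → A} {s : Fin (n + 1) → ι}
    (h : ∀ j : Fin (n + 1), u (j.removeNth s) = v (j.removeNth s)) :
    alternatingFaceSum u s = alternatingFaceSum v s := by
  simp [alternatingFaceSum, h]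

theorem alternatingFaceSum_cons {n : ℕ} (u : (Fin (n + 1) → ι) → A) (i : ι)
    (s : Fin (n + 1) → ι) :
    alternatingFaceSum u (Fin.cons i s : Fin (n + 2) → ι) =
      u s - alternatingFaceSum (fun t => u (Fin.cons i t : Fin (n + 1) → ι)) s := by
  have h : ∀ j : Fin (n + 1), j.succ.removeNth (Fin.cons i s : Fin (n + 2) → ι) =
      (Fin.cons i (j.removeNth s) : Fin (n + 1) → ι) := fun j => by
    ext l
    refine Fin.cases ?_ (fun l => ?_) l <;> simp [Fin.removeNth]
  rw [alternatingFaceSum, Fin.sum_univ_succ, alternatingFaceSum, sub_eq_add_neg,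
    ← Finset.sum_neg_distrib]
  simp [h, pow_succ, Fin.removeNth_zero]

theorem alternatingFaceSum_alternatingFaceSum {n : ℕ} (u : (Fin n → ι) → A)
    (s : Fin (n + 2) → ι) : alternatingFaceSum (alternatingFaceSum u) s = 0 := by
  induction n with
  | zero =>
    have h : ∀ t t' : Fin 0 → ι, u t = u t' := fun t t' => by rw [Subsingleton.elim t t']
    simp [alternatingFaceSum, Fin.sum_univ_succ, h _ default]
  | succ n ih =>
    obtain ⟨i, s, rfl⟩ : ∃ i s', s = (Fin.cons i s' : Fin (n + 3) → ι) :=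
      ⟨s 0, Fin.tail s, (Fin.cons_self_tail s).symm⟩
    have h : (fun t : Fin (n + 1) → ι =>
        alternatingFaceSum u (Fin.cons i t : Fin (n + 2) → ι)) =
        fun t => u t - alternatingFaceSum (fun t => u (Fin.cons i t : Fin (n + 1) → ι)) t :=
      funext fun t => alternatingFaceSum_cons u i t
    have hsub : ∀ v w : (Fin (n + 1) → ι) → A, ∀ s,
        alternatingFaceSum (fun t => v t - w t) s =
          alternatingFaceSum v s - alternatingFaceSum w s := fun v w s => by
      simp [alternatingFaceSum, smul_sub, Finset.sum_sub_distrib]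
    rw [alternatingFaceSum_cons, h, hsub, sub_sub_cancel]
    exact ih _ _

end AlternatingSums

noncomputable section Taylor

variable {k : Type*} [CommRing k] {σ ι : Type*} (m : ι → σ →₀ ℕ)

/-- The exponent of the least common multiple of the monomials indexed by a tuple. -/
def lcmExponent {n : ℕ} (s : Fin n → ι) : σ →₀ ℕ :=
  Finset.univ.sup fun i => m (s i)

theorem lcmExponent_removeNth_le {n : ℕ} (s : Fin (n + 1) → ι) (j : Fin (n + 1)) :
    lcmExponent m (j.removeNth s) ≤ lcmExponent m s :=
  Finset.sup_le fun i _ =>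
    Finset.le_sup (f := fun i => m (s i)) (Finset.mem_univ (j.succAbove i))

theorem lcmExponent_cons {n : ℕ} (i : ι) (s : Fin n → ι) :
    lcmExponent m (Fin.cons i s : Fin (n + 1) → ι) = m i ⊔ lcmExponent m s := by
  apply le_antisymm
  · refine Finset.sup_le fun l _ => ?_
    refine Fin.cases ?_ (fun l => ?_) l
    · simp
    · exact le_sup_of_le_right (Finset.le_sup (f := fun i => m (s i)) (Finset.mem_univ l))
  · refine sup_le ?_ ?_
    · exact Finset.le_sup (f := fun l => m ((Fin.cons i s : Fin (n + 1) → ι) l))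
        (Finset.mem_univ 0)
    · refine Finset.sup_le fun l _ => ?_
      exact Finset.le_sup (f := fun l => m ((Fin.cons i s : Fin (n + 1) → ι) l))
        (Finset.mem_univ l.succ)

theorem lcmExponent_zero (s : Fin 0 → ι) : lcmExponent m s = 0 := by
  rw [lcmExponent, Finset.univ_eq_empty, Finset.sup_empty, bot_eq_zero]

theorem lcmExponent_smul (q : ℕ) {n : ℕ} (s : Fin n → ι) :
    lcmExponent (fun i => q • m i) s = q • lcmExponent m s := by
  induction n with
  | zero => simp [lcmExponent_zero]
  | succ n ih =>
    obtain ⟨i, s, rfl⟩ : ∃ i s', s = (Fin.cons i s' : Fin (n + 1) → ι) :=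
      ⟨s 0, Fin.tail s, (Fin.cons_self_tail s).symm⟩
    rw [lcmExponent_cons, lcmExponent_cons, ih]
    ext x
    simp [Nat.mul_max_mul_left]

variable (k)

/-- The differential of the (unnormalized) Taylor complex of a family of monomials. -/
def taylorD (n : ℕ) : ((Fin (n + 1) → ι) →₀ MvPolynomial σ k) →ₗ[MvPolynomial σ k]
    ((Fin n → ι) →₀ MvPolynomial σ k) :=
  Finsupp.linearCombination _ fun s => alternatingFaceSum
    (fun t => Finsupp.single t (monomial (lcmExponent m s - lcmExponent m t) (1 : k))) s

/-- The differential of the dual of the Taylor complex. -/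
def taylorCoD (n : ℕ) : ((Fin n → ι) → MvPolynomial σ k) →ₗ[MvPolynomial σ k]
    ((Fin (n + 1) → ι) → MvPolynomial σ k) where
  toFun f s := alternatingFaceSum
    (fun t => monomial (lcmExponent m s - lcmExponent m t) (1 : k) * f t) s
  map_add' f g := by
    ext1 s
    simp [alternatingFaceSum, mul_add, Finset.sum_add_distrib]
  map_smul' r f := by
    ext1 s
    simp only [alternatingFaceSum, Pi.smul_apply, smul_eq_mul, Finset.mul_sum, RingHom.id_apply,
      mul_smul_comm, mul_left_comm r]

variable {k}

theorem taylorCoD_apply {n : ℕ} (f : (Fin n → ι) → MvPolynomial σ k) (s : Fin (n + 1) → ι) :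
    taylorCoD k m n f s = alternatingFaceSum
      (fun t => monomial (lcmExponent m s - lcmExponent m t) (1 : k) * f t) s := rfl

theorem map_taylorD_single {n : ℕ} (f : ((Fin n → ι) →₀ MvPolynomial σ k)
    →ₗ[MvPolynomial σ k] MvPolynomial σ k) (s : Fin (n + 1) → ι) :
    f (taylorD k m n (Finsupp.single s 1)) =
      taylorCoD k m n (fun t => f (Finsupp.single t 1)) s := by
  rw [taylorD, Finsupp.linearCombination_single, one_smul, map_alternatingFaceSum, taylorCoD_apply]
  refine alternatingFaceSum_congr fun j => ?_
  rw [← smul_eq_mul, ← map_smul, Finsupp.smul_single, smul_eq_mul, mul_one]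

/-- The basis vector indexed by a tuple, scaled by the monomial that brings it to the multidegree
`D`. -/
def taylorTerm {n : ℕ} (D : σ →₀ ℕ) (a : k) (s : Fin n → ι) :
    (Fin n → ι) →₀ MvPolynomial σ k :=
  Finsupp.single s (monomial (D - lcmExponent m s) a)

theorem taylorD_taylorTerm {n : ℕ} {D : σ →₀ ℕ} (a : k) {s : Fin (n + 1) → ι}
    (hs : lcmExponent m s ≤ D) :
    taylorD k m n (taylorTerm m D a s) = alternatingFaceSum (taylorTerm m D a) s := by
  rw [taylorD, taylorTerm, Finsupp.linearCombination_single]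
  change DistribSMul.toAddMonoidHom _ (monomial (D - lcmExponent m s) a) _ = _
  rw [map_alternatingFaceSum]
  refine alternatingFaceSum_congr fun j => ?_
  have h : D - lcmExponent m s + (lcmExponent m s - lcmExponent m (j.removeNth s)) =
      D - lcmExponent m (j.removeNth s) :=
    tsub_add_tsub_cancel hs (lcmExponent_removeNth_le m s j)
  simp [taylorTerm, monomial_mul, h]

theorem single_monomial_eq_taylorTerm {n : ℕ} (s : Fin n → ι) (e : σ →₀ ℕ) (a : k) :
    Finsupp.single s (monomial e a) = taylorTerm m (e + lcmExponent m s) a s := by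
  rw [taylorTerm, add_tsub_cancel_right]

/-- Additive maps out of a term of the Taylor complex are determined by their values on the
multihomogeneous elements. -/
theorem taylor_addHom_ext {n : ℕ} {A : Type*} [AddCommMonoid A]
    {f g : ((Fin n → ι) →₀ MvPolynomial σ k) →+ A}
    (h : ∀ D a s, lcmExponent m s ≤ D → f (taylorTerm m D a s) = g (taylorTerm m D a s)) :
    f = g := by
  refine Finsupp.addHom_ext fun s p => ?_
  induction p using MvPolynomial.induction_on' with
  | monomial e a =>
    rw [single_monomial_eq_taylorTerm m]
    exact h _ _ _ le_add_self
  | add p q hp hq => rw [Finsupp.single_add, map_add, map_add, hp, hq]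

theorem taylorD_comp_taylorD (n : ℕ) : taylorD k m n ∘ₗ taylorD k m (n + 1) = 0 := by
  refine LinearMap.toAddMonoidHom_injective (taylor_addHom_ext m fun D a s hs => ?_)
  simp only [LinearMap.toAddMonoidHom_coe, LinearMap.comp_apply, LinearMap.zero_apply]
  rw [taylorD_taylorTerm m a hs, map_alternatingFaceSum,
    ← alternatingFaceSum_alternatingFaceSum (taylorTerm m D a) s]
  exact alternatingFaceSum_congr fun j =>
    taylorD_taylorTerm m a ((lcmExponent_removeNth_le m s j).trans hs)

open Classical in
/-- The contracting homotopy of the Taylor complex in positive degrees: prepend to a tuple an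
index, chosen depending on the multidegree only. -/
def taylorHomotopy (n : ℕ) : ((Fin n → ι) →₀ MvPolynomial σ k) →+
    ((Fin (n + 1) → ι) →₀ MvPolynomial σ k) :=
  Finsupp.liftAddHom fun s => (Finsupp.liftAddHom fun e : σ →₀ ℕ =>
    if h : ∃ i, m i ≤ e + lcmExponent m s then
      (Finsupp.singleAddHom (Fin.cons h.choose s : Fin (n + 1) → ι)).comp
        (monomial (e + lcmExponent m s -
          lcmExponent m (Fin.cons h.choose s : Fin (n + 1) → ι))).toAddMonoidHom
    else 0).comp (AddMonoidAlgebra.coeffAddEquiv (R := k) (M := σ →₀ ℕ)).toAddMonoidHom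

theorem taylorHomotopy_taylorTerm {D : σ →₀ ℕ} (hD : ∃ i, m i ≤ D) {n : ℕ} (a : k)
    {s : Fin n → ι} (hs : lcmExponent m s ≤ D) :
    taylorHomotopy m n (taylorTerm m D a s) =
      taylorTerm m D a (Fin.cons hD.choose s : Fin (n + 1) → ι) := by
  obtain ⟨e, rfl⟩ : ∃ e, D = e + lcmExponent m s := ⟨D - lcmExponent m s, by
    rw [tsub_add_cancel_of_le hs]⟩
  rw [← single_monomial_eq_taylorTerm, taylorHomotopy, Finsupp.liftAddHom_apply_single]
  simp [dif_pos hD, monomial, taylorTerm]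

theorem taylorD_taylorHomotopy (n : ℕ) (x : (Fin (n + 1) → ι) →₀ MvPolynomial σ k) :
    taylorD k m (n + 1) (taylorHomotopy m (n + 1) x) +
      taylorHomotopy m n (taylorD k m n x) = x := by
  let F : ((Fin (n + 1) → ι) →₀ MvPolynomial σ k) →+ ((Fin (n + 1) → ι) →₀ MvPolynomial σ k) :=
    (taylorD k m (n + 1)).toAddMonoidHom.comp (taylorHomotopy m (n + 1)) +
      (taylorHomotopy m n).comp (taylorD k m n).toAddMonoidHom
  suffices h : F = AddMonoidHom.id _ from DFunLike.congr_fun h x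
  refine taylor_addHom_ext m fun D a s hs => ?_
  have hD : ∃ i, m i ≤ D :=
    ⟨s 0, (Finset.le_sup (f := fun i => m (s i)) (Finset.mem_univ 0)).trans hs⟩
  have hcons : lcmExponent m (Fin.cons hD.choose s : Fin (n + 2) → ι) ≤ D := by
    rw [lcmExponent_cons]
    exact sup_le hD.choose_spec hs
  simp only [F, AddMonoidHom.add_apply, AddMonoidHom.comp_apply, LinearMap.toAddMonoidHom_coe,
    AddMonoidHom.id_apply]
  rw [taylorHomotopy_taylorTerm m hD a hs, taylorD_taylorTerm m a hcons, taylorD_taylorTerm m a hs,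
    map_alternatingFaceSum, alternatingFaceSum_cons, sub_add_eq_add_sub, sub_eq_iff_eq_add]
  congr 1
  exact alternatingFaceSum_congr fun j =>
    taylorHomotopy_taylorTerm m hD a ((lcmExponent_removeNth_le m s j).trans hs)

theorem taylorD_exact (n : ℕ) (x : (Fin (n + 1) → ι) →₀ MvPolynomial σ k)
    (hx : taylorD k m n x = 0) : ∃ y, taylorD k m (n + 1) y = x :=
  ⟨taylorHomotopy m (n + 1) x, by simpa [hx] using taylorD_taylorHomotopy m n x⟩

/-- The augmentation of the Taylor complex. -/
def taylorAug (I : Ideal (MvPolynomial σ k)) : ((Fin 0 → ι) →₀ MvPolynomial σ k)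
    →ₗ[MvPolynomial σ k] MvPolynomial σ k ⧸ I :=
  Submodule.mkQ I ∘ₗ Finsupp.lapply default

theorem taylorAug_surjective (I : Ideal (MvPolynomial σ k)) :
    Function.Surjective (taylorAug (ι := ι) I) := fun x => by
  obtain ⟨p, rfl⟩ := Ideal.Quotient.mk_surjective x
  refine ⟨Finsupp.single default p, ?_⟩
  rw [taylorAug, LinearMap.comp_apply, Finsupp.lapply_apply, Finsupp.single_eq_same]
  rfl

theorem taylorAug_eq_zero_iff {I : Ideal (MvPolynomial σ k)}
    (hI : I = Ideal.span (Set.range fun i => monomial (m i) (1 : k)))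
    (x : (Fin 0 → ι) →₀ MvPolynomial σ k) :
    taylorAug I x = 0 ↔ ∃ y, taylorD k m 0 y = x := by
  have hx : x = Finsupp.single default (x default) := by
    refine Finsupp.ext fun t => ?_
    rw [Subsingleton.elim t default, Finsupp.single_eq_same]
  have haug : taylorAug I x = Ideal.Quotient.mk I (x default) := rfl
  have hD : ∀ (s : Fin 1 → ι) (p : MvPolynomial σ k), taylorD k m 0 (Finsupp.single s p) =
      Finsupp.single default (p * monomial (m (s 0)) 1) := fun s p => by
    have hs : lcmExponent m s = m (s 0) := by simp [lcmExponent]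
    rw [taylorD, Finsupp.linearCombination_single, alternatingFaceSum, Fin.sum_univ_one,
      lcmExponent_zero, hs, tsub_zero, Subsingleton.elim (Fin.removeNth _ s) default]
    simp
  rw [haug, Ideal.Quotient.eq_zero_iff_mem, hI, Ideal.span]
  constructor
  · intro h
    obtain ⟨c, hc⟩ := (Finsupp.mem_span_range_iff_exists_finsupp).1 h
    refine ⟨c.mapDomain fun i _ => i, ?_⟩
    rw [hx, ← hc, Finsupp.mapDomain, Finsupp.sum, map_sum, Finsupp.sum, Finsupp.single_finsetSum]
    exact Finset.sum_congr rfl fun i _ => hD _ _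
  · clear hx haug
    rintro ⟨y, rfl⟩
    induction y using Finsupp.induction_linear with
    | zero => simp
    | add f g hf hg =>
      rw [map_add, Finsupp.add_apply]
      exact add_mem hf hg
    | single s p =>
      rw [hD, Finsupp.single_eq_same]
      exact Ideal.mul_mem_left _ _ (Ideal.subset_span ⟨s 0, rfl⟩)

end Taylor

noncomputable section TaylorCochains

variable {k : Type*} [CommRing k] {σ ι : Type*} (m : ι → σ →₀ ℕ)

variable (k) in
/-- The coboundaries of the dual of the Taylor complex. -/
def taylorCoboundaries : ∀ n : ℕ, Submodule (MvPolynomial σ k) ((Fin n → ι) → MvPolynomial σ k)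
  | 0 => ⊥
  | n + 1 => LinearMap.range (taylorCoD k m n)

theorem map_mem_taylorCoboundaries {m m' : ι → σ →₀ ℕ}
    (F : ∀ n, ((Fin n → ι) → MvPolynomial σ k) →+ ((Fin n → ι) → MvPolynomial σ k))
    (hF : ∀ n f, taylorCoD k m' n (F n f) = F (n + 1) (taylorCoD k m n f)) {n : ℕ}
    {f : (Fin n → ι) → MvPolynomial σ k} (hf : f ∈ taylorCoboundaries k m n) :
    F n f ∈ taylorCoboundaries k m' n := by
  cases n with
  | zero =>
    obtain rfl : f = 0 := hf
    rw [map_zero]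
    exact zero_mem _
  | succ n =>
    obtain ⟨g, rfl⟩ := hf
    exact ⟨F n g, hF n g⟩

/-- The map of dual Taylor complexes induced by the projection from the quotient by a bracket power
to the quotient by the original ideal. -/
def taylorCoIncl (q n : ℕ) : ((Fin n → ι) → MvPolynomial σ k) →ₗ[MvPolynomial σ k]
    ((Fin n → ι) → MvPolynomial σ k) :=
  LinearMap.pi fun s =>
    LinearMap.mulLeft _ (monomial ((q - 1) • lcmExponent m s) (1 : k)) ∘ₗ LinearMap.proj s

theorem taylorCoIncl_apply (q n : ℕ) (f : (Fin n → ι) → MvPolynomial σ k) (s : Fin n → ι) :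
    taylorCoIncl m q n f s = monomial ((q - 1) • lcmExponent m s) 1 * f s := rfl

theorem taylorCoD_taylorCoIncl {q : ℕ} (hq : 1 ≤ q) (n : ℕ)
    (f : (Fin n → ι) → MvPolynomial σ k) :
    taylorCoD k (fun i => q • m i) n (taylorCoIncl m q n f) =
      taylorCoIncl m q (n + 1) (taylorCoD k m n f) := by
  ext1 s
  change _ = AddMonoidHom.mulLeft (monomial ((q - 1) • lcmExponent m s) (1 : k))
    (taylorCoD k m n f s)
  rw [taylorCoD_apply, taylorCoD_apply, map_alternatingFaceSum]
  refine alternatingFaceSum_congr fun j => ?_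
  obtain ⟨D, hD⟩ := exists_add_of_le (lcmExponent_removeNth_le m s j)
  obtain ⟨q, rfl⟩ := Nat.exists_eq_add_of_le' hq
  rw [taylorCoIncl_apply, AddMonoidHom.coe_mulLeft, ← mul_assoc, ← mul_assoc, monomial_mul,
    monomial_mul, lcmExponent_smul, lcmExponent_smul, hD, smul_add, add_tsub_cancel_left,
    add_tsub_cancel_left, add_tsub_cancel_right]
  congr 3
  simp only [add_smul, smul_add, one_smul]
  abel

/-- A retraction of `taylorCoIncl` as a map of additive groups. -/
def taylorCoRetr (q n : ℕ) : ((Fin n → ι) → MvPolynomial σ k) →+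
    ((Fin n → ι) → MvPolynomial σ k) where
  toFun f s := (f s).divMonomial ((q - 1) • lcmExponent m s)
  map_zero' := by
    ext1 s
    simp
  map_add' f g := by
    ext1 s
    simp [add_divMonomial]

theorem taylorCoRetr_apply (q n : ℕ) (f : (Fin n → ι) → MvPolynomial σ k) (s : Fin n → ι) :
    taylorCoRetr m q n f s = (f s).divMonomial ((q - 1) • lcmExponent m s) := rfl

theorem taylorCoRetr_taylorCoIncl (q n : ℕ) (f : (Fin n → ι) → MvPolynomial σ k) :
    taylorCoRetr m q n (taylorCoIncl m q n f) = f := by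
  ext1 s
  rw [taylorCoRetr_apply, taylorCoIncl_apply, divMonomial_monomial_mul]

theorem divMonomial_monomial_mul_of_disjoint {a b : σ →₀ ℕ} (hab : ∀ x, a x = 0 ∨ b x = 0)
    (p : MvPolynomial σ k) :
    (monomial a 1 * p).divMonomial b = monomial a 1 * p.divMonomial b := by
  ext e
  rw [coeff_divMonomial, coeff_monomial_mul', coeff_monomial_mul', coeff_divMonomial]
  have h : a ≤ b + e ↔ a ≤ e := by
    simp only [Finsupp.le_def, Finsupp.add_apply]
    refine forall_congr' fun x => ?_
    have := hab x
    lia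
  by_cases hae : a ≤ e
  · rw [if_pos (h.2 hae), if_pos hae, add_tsub_assoc_of_le hae]
  · rw [if_neg (h.not.2 hae), if_neg hae]

theorem lcmExponent_apply_le_one (hm : ∀ i x, m i x ≤ 1) {n : ℕ} (s : Fin n → ι) (x : σ) :
    lcmExponent m s x ≤ 1 := by
  induction n with
  | zero => simp [lcmExponent_zero]
  | succ n ih =>
    rw [← Fin.cons_self_tail s, lcmExponent_cons, Finsupp.sup_apply]
    exact sup_le (hm _ _) (ih _)

theorem taylorCoD_taylorCoRetr (hm : ∀ i x, m i x ≤ 1) {q : ℕ} (hq : 1 ≤ q) (n : ℕ)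
    (f : (Fin n → ι) → MvPolynomial σ k) :
    taylorCoD k m n (taylorCoRetr m q n f) =
      taylorCoRetr m q (n + 1) (taylorCoD k (fun i => q • m i) n f) := by
  ext1 s
  let div : MvPolynomial σ k →+ MvPolynomial σ k :=
    { toFun := fun p => p.divMonomial ((q - 1) • lcmExponent m s)
      map_zero' := zero_divMonomial _
      map_add' := fun p p' => add_divMonomial p p' _ }
  change _ = div _
  rw [taylorCoD_apply, taylorCoD_apply, map_alternatingFaceSum]
  refine alternatingFaceSum_congr fun j => ?_
  obtain ⟨D, hD⟩ := exists_add_of_le (lcmExponent_removeNth_le m s j)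
  obtain ⟨q, rfl⟩ := Nat.exists_eq_add_of_le' hq
  have h : (q + 1) • D = q • D + D := by rw [add_smul, one_smul]
  change _ = divMonomial _ _
  rw [taylorCoRetr_apply, lcmExponent_smul, lcmExponent_smul, hD, smul_add, smul_add,
    add_tsub_cancel_left, add_tsub_cancel_left, add_tsub_cancel_right, add_comm (q • _),
    divMonomial_add, h, ← one_mul (1 : k), ← monomial_mul, one_mul, mul_assoc,
    divMonomial_monomial_mul, divMonomial_monomial_mul_of_disjoint]
  intro x
  have := lcmExponent_apply_le_one m hm s x
  rw [hD, Finsupp.add_apply] at this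
  rw [Finsupp.smul_apply, smul_eq_mul, mul_eq_zero]
  lia

end TaylorCochains

noncomputable section ExpandCoeff

variable {k : Type*} [CommRing k] {σ : Type*}

open Classical in
/-- The coefficient of a polynomial at the monomial with exponent `c`, with respect to the basis
of the polynomial ring, considered as a module over itself via `expand q`, consisting of the
monomials all of whose exponents are less than `q`. -/
def expandCoeff (q : ℕ) (c : σ → Fin q) : MvPolynomial σ k →ₗ[k] MvPolynomial σ k :=
  (basisMonomials σ k).constr k fun e =>
    if ∀ x, e x % q = c x then monomial (e.mapRange (· / q) (Nat.zero_div q)) 1 else 0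

open Classical in
theorem expandCoeff_monomial (q : ℕ) (c : σ → Fin q) (e : σ →₀ ℕ) (a : k) :
    expandCoeff q c (monomial e a) =
      if ∀ x, e x % q = c x then monomial (e.mapRange (· / q) (Nat.zero_div q)) a else 0 := by
  have h : monomial e a = a • basisMonomials σ k e := by
    rw [coe_basisMonomials, smul_monomial, smul_eq_mul, mul_one]
  rw [h, map_smul, expandCoeff, Module.Basis.constr_basis, smul_ite, smul_monomial, smul_eq_mul,
    mul_one, smul_zero]

theorem expandCoeff_mul_expand {q : ℕ} (hq : 0 < q) (c : σ → Fin q) (r p : MvPolynomial σ k) :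
    expandCoeff q c (r * expand q p) = expandCoeff q c r * p := by
  classical
  induction p using MvPolynomial.induction_on' with
  | add p p' hp hp' => rw [map_add, mul_add, map_add, hp, hp', mul_add]
  | monomial e a =>
    induction r using MvPolynomial.induction_on' with
    | add r r' hr hr' => rw [add_mul, map_add, hr, hr', map_add, add_mul]
    | monomial e' a' =>
      rw [expand_monomial, monomial_mul, expandCoeff_monomial, expandCoeff_monomial, ite_mul,
        zero_mul, monomial_mul]
      simp only [Finsupp.add_apply, Finsupp.smul_apply, smul_eq_mul, Nat.add_mul_mod_self_left]
      have h : (e' + q • e).mapRange (· / q) (Nat.zero_div q) =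
          e'.mapRange (· / q) (Nat.zero_div q) + e := by
        ext x
        simp [Nat.add_mul_div_left _ _ hq]
      rw [h]

theorem expandCoeff_expand_mul {q : ℕ} (hq : 0 < q) (c : σ → Fin q) (r p : MvPolynomial σ k) :
    expandCoeff q c (expand q p * r) = p * expandCoeff q c r := by
  rw [mul_comm, expandCoeff_mul_expand hq, mul_comm]

theorem sum_monomial_mul_expand_expandCoeff [Fintype σ] [DecidableEq σ] {q : ℕ} (hq : 0 < q)
    (r : MvPolynomial σ k) :
    ∑ c : σ → Fin q, monomial (Finsupp.equivFunOnFinite.symm fun x => (c x : ℕ)) 1 *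
      expand q (expandCoeff q c r) = r := by
  classical
  induction r using MvPolynomial.induction_on' with
  | add r r' hr hr' =>
    simp only [map_add, mul_add, Finset.sum_add_distrib]
    rw [hr, hr']
  | monomial e a =>
    rw [Finset.sum_eq_single (fun x => ⟨e x % q, Nat.mod_lt _ hq⟩)]
    · rw [expandCoeff_monomial, if_pos fun _ => rfl, expand_monomial, monomial_mul, one_mul]
      have h : (Finsupp.equivFunOnFinite.symm fun x => e x % q) +
          q • e.mapRange (· / q) (Nat.zero_div q) = e := by
        ext x
        simp [Nat.mod_add_div]
      exact congrArg (monomial · a) h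
    · intro c _ hc
      rw [expandCoeff_monomial, if_neg, map_zero, mul_zero]
      exact fun h => hc (funext fun x => Fin.ext (h x).symm)
    · exact fun h => absurd (Finset.mem_univ _) h

end ExpandCoeff

noncomputable section TaylorResolution

theorem exists_cycle_presentation {R : Type} [CommRing R] (S : ShortComplex (ModuleCat.{0} R)) :
    ∃ π : LinearMap.ker S.g.hom →ₗ[R] S.homology,
      Function.Surjective π ∧ ∀ z, π z = 0 ↔ ∃ y, S.f y = z.1 := by
  let e : (LinearMap.ker S.g.hom ⧸ LinearMap.range S.moduleCatToCycles) ≃ₗ[R] S.homology :=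
    S.moduleCatHomologyIso.toLinearEquiv.symm
  refine ⟨e.toLinearMap ∘ₗ (LinearMap.range S.moduleCatToCycles).mkQ, ?_, fun z => ?_⟩
  · rw [LinearMap.coe_comp]
    exact e.surjective.comp (Submodule.mkQ_surjective _)
  · rw [LinearMap.comp_apply, LinearEquiv.coe_coe, LinearEquiv.map_eq_zero_iff,
      Submodule.mkQ_apply, Submodule.Quotient.mk_eq_zero]
    constructor
    · rintro ⟨y, hy⟩
      exact ⟨y, congrArg Subtype.val hy⟩
    · rintro ⟨y, hy⟩
      exact ⟨y, Subtype.ext hy⟩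

theorem exists_cocycle_presentation {R : Type} [CommRing R] (K : CochainComplex (ModuleCat.{0} R) ℕ)
    (n : ℕ) : ∃ π : LinearMap.ker (K.d n (n + 1)).hom →ₗ[R] K.homology n,
      Function.Surjective π ∧
        ∀ z, π z = 0 ↔ ∃ y, K.d ((ComplexShape.up ℕ).prev n) n y = z.1 := by
  obtain ⟨π, hπ, hπ0⟩ := exists_cycle_presentation (K.sc' ((ComplexShape.up ℕ).prev n) n (n + 1))
  let e : (K.sc' ((ComplexShape.up ℕ).prev n) n (n + 1)).homology ≃ₗ[R] K.homology n :=
    (ShortComplex.homologyMapIso (K.isoSc' _ n (n + 1) rfl (by simp))).toLinearEquiv.symm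
  refine ⟨e.toLinearMap ∘ₗ π, ?_, fun z => ?_⟩
  · exact e.surjective.comp hπ
  · exact e.map_eq_zero_iff.trans (hπ0 z)

variable {k : Type} [CommRing k] {σ ι : Type} (m : ι → σ →₀ ℕ)

variable (k) in
/-- The Taylor complex as a chain complex in the category of modules. -/
def taylorComplex : ChainComplex (ModuleCat.{0} (MvPolynomial σ k)) ℕ :=
  ChainComplex.of (fun n => ModuleCat.of _ ((Fin n → ι) →₀ MvPolynomial σ k))
    (fun n => ModuleCat.ofHom (taylorD k m n)) fun n => by
      rw [← ModuleCat.ofHom_comp, taylorD_comp_taylorD]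
      rfl

theorem taylorComplex_d (n : ℕ) :
    (taylorComplex k m).d (n + 1) n = ModuleCat.ofHom (taylorD k m n) := by
  simp [taylorComplex]

/-- The Taylor complex as a projective resolution of the quotient by a monomial ideal. -/
def taylorResolution {I : Ideal (MvPolynomial σ k)}
    (hI : I = Ideal.span (Set.range fun i => monomial (m i) (1 : k))) :
    ProjectiveResolution (ModuleCat.of (MvPolynomial σ k) (MvPolynomial σ k ⧸ I)) where
  complex := taylorComplex k m
  projective n := ModuleCat.projective_of_free
    (M := ModuleCat.of (MvPolynomial σ k) ((Fin n → ι) →₀ MvPolynomial σ k))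
    Finsupp.basisSingleOne
  π := (ChainComplex.toSingle₀Equiv _ _).symm ⟨ModuleCat.ofHom (taylorAug I), by
    rw [taylorComplex_d]
    ext1
    exact LinearMap.ext fun y => (taylorAug_eq_zero_iff m hI _).2 ⟨y, rfl⟩⟩
  quasiIso := ⟨fun n => by
    cases n with
    | zero =>
      rw [ChainComplex.quasiIsoAt₀_iff, ShortComplex.quasiIso_iff_of_zeros']
      · refine ⟨?_, ?_⟩
        · rw [ShortComplex.moduleCat_exact_iff]
          intro x hx
          obtain ⟨y, hy⟩ := (taylorAug_eq_zero_iff m hI x).1 hx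
          refine ⟨y, Eq.trans ?_ hy⟩
          change (taylorComplex k m).d 1 0 y = _
          rw [taylorComplex_d]
          rfl
        · rw [ModuleCat.epi_iff_surjective]
          exact taylorAug_surjective I
      all_goals rfl
    | succ n =>
      rw [quasiIsoAt_iff_exactAt']
      · rw [HomologicalComplex.exactAt_iff' _ (n + 1 + 1) (n + 1) n (by simp) (by simp),
          ShortComplex.moduleCat_exact_iff]
        intro x hx
        have hx' : (taylorComplex k m).d (n + 1) n x = 0 := hx
        rw [taylorComplex_d] at hx'
        obtain ⟨y, hy⟩ := taylorD_exact m n x hx'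
        refine ⟨y, Eq.trans ?_ hy⟩
        change (taylorComplex k m).d (n + 2) (n + 1) y = _
        rw [taylorComplex_d]
        rfl
      · apply ChainComplex.exactAt_succ_single_obj⟩

/-- The cochain complex computing the modules `Ext` is the dual of the Taylor complex. -/
def taylorCoEquiv (n : ℕ) : ((taylorComplex k m).linearYonedaObj (MvPolynomial σ k)
    (ModuleCat.of _ (MvPolynomial σ k))).X n ≃ₗ[MvPolynomial σ k]
      ((Fin n → ι) → MvPolynomial σ k) :=
  { toFun := fun f t => ModuleCat.Hom.hom f (Finsupp.single t 1)
    map_add' := fun f g => rfl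
    map_smul' := fun r f => rfl
    invFun := fun f => ModuleCat.ofHom (Finsupp.linearCombination _ f)
    left_inv := fun f => by
      refine ModuleCat.hom_ext (Finsupp.lhom_ext' fun t => LinearMap.ext_ring ?_)
      exact (Finsupp.linearCombination_single _ _ _).trans (one_smul _ _)
    right_inv := fun f => by
      ext1 t
      exact (Finsupp.linearCombination_single _ _ _).trans (one_smul _ _) }

theorem taylorCoEquiv_d (n : ℕ) (f : ((taylorComplex k m).linearYonedaObj (MvPolynomial σ k)
    (ModuleCat.of _ (MvPolynomial σ k))).X n) :
    taylorCoEquiv m (n + 1) (((taylorComplex k m).linearYonedaObj (MvPolynomial σ k)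
      (ModuleCat.of _ (MvPolynomial σ k))).d n (n + 1) f) =
      taylorCoD k m n (taylorCoEquiv m n f) := by
  ext1 s
  refine Eq.trans ?_ (map_taylorD_single m (ModuleCat.Hom.hom f) s)
  rw [← ModuleCat.hom_ofHom (taylorD k m n), ← taylorComplex_d]
  rfl

theorem exists_ext_presentation {I : Ideal (MvPolynomial σ k)}
    (hI : I = Ideal.span (Set.range fun i => monomial (m i) (1 : k))) (n : ℕ) :
    ∃ π : LinearMap.ker (taylorCoD k m n) →ₗ[MvPolynomial σ k]
        ((Ext (MvPolynomial σ k) (ModuleCat (MvPolynomial σ k)) n).obj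
          (op (ModuleCat.of _ (MvPolynomial σ k ⧸ I)))).obj (ModuleCat.of _ (MvPolynomial σ k)),
      Function.Surjective π ∧ ∀ z, π z = 0 ↔ z.1 ∈ taylorCoboundaries k m n := by
  let K := (taylorComplex k m).linearYonedaObj (MvPolynomial σ k)
    (ModuleCat.of _ (MvPolynomial σ k))
  obtain ⟨π, hπ, hπ0⟩ := exists_cocycle_presentation K n
  let e := ((taylorResolution m hI).isoExt
    (R := MvPolynomial σ k) n (ModuleCat.of _ (MvPolynomial σ k))).symm.toLinearEquiv
  let c : LinearMap.ker (taylorCoD k m n) →ₗ[MvPolynomial σ k] LinearMap.ker (K.d n (n + 1)).hom :=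
    ((taylorCoEquiv m n).symm.toLinearMap ∘ₗ Submodule.subtype _).codRestrict _ fun z => by
      refine (taylorCoEquiv m (n + 1)).injective ((taylorCoEquiv_d m n _).trans ?_)
      rw [map_zero]
      exact (congrArg _ ((taylorCoEquiv m n).apply_symm_apply _)).trans z.2
  have hc : Function.Surjective c := fun w => by
    refine ⟨⟨taylorCoEquiv m n w.1, ?_⟩, Subtype.ext ((taylorCoEquiv m n).symm_apply_apply _)⟩
    refine (taylorCoEquiv_d m n _).symm.trans ?_
    exact (congrArg _ w.2).trans (map_zero _)
  refine ⟨e.toLinearMap ∘ₗ π ∘ₗ c, e.surjective.comp (hπ.comp hc), fun z => ?_⟩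
  refine e.map_eq_zero_iff.trans ((hπ0 _).trans ?_)
  have hcz : ∀ w, w = (c z).1 ↔ taylorCoEquiv m n w = z.1 := fun w =>
    (taylorCoEquiv m n).eq_symm_apply
  simp only [hcz]
  cases n with
  | zero =>
    have h0 : K.d ((ComplexShape.up ℕ).prev 0) 0 = 0 := K.shape _ _ (by simp)
    simp only [h0]
    constructor
    · rintro ⟨y, hy⟩
      exact hy.symm.trans (map_zero _)
    · intro hz
      exact ⟨0, (map_zero _).trans (Eq.symm hz)⟩
  | succ n =>
    rw [CochainComplex.prev_nat_succ]
    constructor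
    · rintro ⟨y, hy⟩
      exact ⟨_, (taylorCoEquiv_d m n y).symm.trans hy⟩
    · rintro ⟨y, hy⟩
      refine ⟨(taylorCoEquiv m n).symm y, (taylorCoEquiv_d m n _).trans ?_⟩
      rw [LinearEquiv.apply_symm_apply]
      exact hy

end TaylorResolution

noncomputable section ExpandCochains

variable {k : Type*} [CommRing k] {σ ι : Type*} (m : ι → σ →₀ ℕ) (q : ℕ)

theorem monomial_lcmExponent_smul_sub {n n' : ℕ} (s : Fin n → ι) (t : Fin n' → ι) :
    monomial (lcmExponent (fun i => q • m i) s - lcmExponent (fun i => q • m i) t) (1 : k) =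
      expand q (monomial (lcmExponent m s - lcmExponent m t) 1) := by
  have h : q • lcmExponent m s - q • lcmExponent m t =
      q • (lcmExponent m s - lcmExponent m t) := by
    ext x
    simp [Nat.mul_sub]
  rw [expand_monomial, lcmExponent_smul, lcmExponent_smul, h]

theorem taylorCoD_expand (n : ℕ) (f : (Fin n → ι) → MvPolynomial σ k) :
    (taylorCoD k (fun i => q • m i) n fun t => expand q (f t)) =
      fun s => expand q (taylorCoD k m n f s) := by
  ext1 s
  rw [taylorCoD_apply, taylorCoD_apply, map_alternatingFaceSum]
  refine alternatingFaceSum_congr fun j => ?_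
  rw [map_mul, monomial_lcmExponent_smul_sub]

theorem taylorCoD_expandCoeff {q : ℕ} (hq : 0 < q) (c : σ → Fin q) (n : ℕ)
    (f : (Fin n → ι) → MvPolynomial σ k) :
    (taylorCoD k m n fun t => expandCoeff q c (f t)) =
      fun s => expandCoeff q c (taylorCoD k (fun i => q • m i) n f s) := by
  ext1 s
  rw [taylorCoD_apply, taylorCoD_apply, map_alternatingFaceSum]
  refine alternatingFaceSum_congr fun j => ?_
  rw [← expandCoeff_expand_mul hq, monomial_lcmExponent_smul_sub]

variable (k) in
/-- The map on cocycles of the dual Taylor complexes given by `expand q`. -/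
def expandCocycle (n : ℕ) : LinearMap.ker (taylorCoD k m n)
    →ₛₗ[(expand q : MvPolynomial σ k →ₐ[k] MvPolynomial σ k).toRingHom]
      LinearMap.ker (taylorCoD k (fun i => q • m i) n) where
  toFun z := ⟨fun t => expand q (z.1 t), by
    rw [LinearMap.mem_ker, taylorCoD_expand, LinearMap.mem_ker.1 z.2]
    exact funext fun s => map_zero _⟩
  map_add' y z := Subtype.ext (funext fun t => map_add _ _ _)
  map_smul' r z := Subtype.ext (funext fun t => map_mul _ _ _)

variable (k) {q} in
/-- The map on cocycles of the dual Taylor complexes given by `expandCoeff q c`. -/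
def expandCoeffCocycle (hq : 0 < q) (c : σ → Fin q) (n : ℕ) :
    LinearMap.ker (taylorCoD k (fun i => q • m i) n) →+ LinearMap.ker (taylorCoD k m n) where
  toFun z := ⟨fun t => expandCoeff q c (z.1 t), by
    rw [LinearMap.mem_ker, taylorCoD_expandCoeff m hq, LinearMap.mem_ker.1 z.2]
    exact funext fun s => map_zero _⟩
  map_zero' := Subtype.ext (funext fun t => map_zero _)
  map_add' y z := Subtype.ext (funext fun t => map_add _ _ _)

variable (k) {q} in
/-- The map on cocycles of the dual Taylor complexes given by `taylorCoIncl`. -/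
def taylorCoInclCocycle (hq : 1 ≤ q) (n : ℕ) : LinearMap.ker (taylorCoD k m n)
    →ₗ[MvPolynomial σ k] LinearMap.ker (taylorCoD k (fun i => q • m i) n) :=
  (taylorCoIncl m q n).restrict fun z hz => by
    rw [LinearMap.mem_ker, taylorCoD_taylorCoIncl m hq, LinearMap.mem_ker.1 hz, map_zero]

variable {q}

theorem taylorCoIncl_mem_taylorCoboundaries_iff (hm : ∀ i x, m i x ≤ 1) (hq : 1 ≤ q) {n : ℕ}
    {f : (Fin n → ι) → MvPolynomial σ k} :
    taylorCoIncl m q n f ∈ taylorCoboundaries k (fun i => q • m i) n ↔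
      f ∈ taylorCoboundaries k m n := by
  refine ⟨fun h => ?_, fun h => ?_⟩
  · rw [← taylorCoRetr_taylorCoIncl m q n f]
    exact map_mem_taylorCoboundaries (taylorCoRetr m q) (taylorCoD_taylorCoRetr m hm hq) h
  · exact map_mem_taylorCoboundaries (fun n => (taylorCoIncl m q n).toAddMonoidHom)
      (taylorCoD_taylorCoIncl m hq) h

theorem expand_mem_taylorCoboundaries {n : ℕ} {f : (Fin n → ι) → MvPolynomial σ k}
    (hf : f ∈ taylorCoboundaries k m n) :
    (fun t => expand q (f t)) ∈ taylorCoboundaries k (fun i => q • m i) n :=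
  map_mem_taylorCoboundaries
    (fun _ => (expand q : MvPolynomial σ k →ₐ[k] _).toRingHom.toAddMonoidHom.compLeft _)
    (taylorCoD_expand m q) hf

theorem expandCoeff_mem_taylorCoboundaries (hq : 0 < q) (c : σ → Fin q) {n : ℕ}
    {f : (Fin n → ι) → MvPolynomial σ k}
    (hf : f ∈ taylorCoboundaries k (fun i => q • m i) n) :
    (fun t => expandCoeff q c (f t)) ∈ taylorCoboundaries k m n :=
  map_mem_taylorCoboundaries
    (fun _ => (expandCoeff q c : MvPolynomial σ k →ₗ[k] _).toAddMonoidHom.compLeft _)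
    (taylorCoD_expandCoeff m hq c) hf

end ExpandCochains

/-- For a squarefree monomial ideal `I` in `R = k[x₁,…,x_d]` and the map
`F_q : xᵢ ↦ xᵢ^q`, `Ext^j_R(R/I, R)` embeds into `Ext^j_R(R/I^{[q]}, R)` and moreover
`Ext^j_R(R/I^{[q]}, R)` is the base change `F_q(Ext^j_R(R/I, R))`, expressed by the
universal property of extension of scalars via `F_q`-semilinear maps. -/
theorem ext_bracketPower_injection_and_baseChange
    (k : Type) [Field k] (d q : ℕ) (hq : 1 < q)
    (φ : MvPolynomial (Fin d) k →ₐ[k] MvPolynomial (Fin d) k)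
    (hφ : ∀ i, φ (X i) = X i ^ q)
    (S : Set (Fin d →₀ ℕ)) (hS : ∀ a ∈ S, ∀ i, a i ≤ 1)
    (I : Ideal (MvPolynomial (Fin d) k))
    (hI : I = Ideal.span ((fun a => monomial a (1 : k)) '' S))
    (Iq : Ideal (MvPolynomial (Fin d) k))
    (hIq : Iq = Ideal.span ((fun a => monomial (q • a) (1 : k)) '' S))
    (j : ℕ) :
    (∃ f : (ExtMod (MvPolynomial (Fin d) k) j
          (ModuleCat.of _ (MvPolynomial (Fin d) k ⧸ I)) (ModuleCat.of _ (MvPolynomial (Fin d) k))) →ₗ[MvPolynomial (Fin d) k]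
        (ExtMod (MvPolynomial (Fin d) k) j
          (ModuleCat.of _ (MvPolynomial (Fin d) k ⧸ Iq)) (ModuleCat.of _ (MvPolynomial (Fin d) k))),
      Function.Injective f) ∧
    ∃ g : (ExtMod (MvPolynomial (Fin d) k) j
          (ModuleCat.of _ (MvPolynomial (Fin d) k ⧸ I)) (ModuleCat.of _ (MvPolynomial (Fin d) k)))
        →ₛₗ[φ.toRingHom]
        (ExtMod (MvPolynomial (Fin d) k) j
          (ModuleCat.of _ (MvPolynomial (Fin d) k ⧸ Iq)) (ModuleCat.of _ (MvPolynomial (Fin d) k))),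
      ∀ (P : Type) [AddCommGroup P] [Module (MvPolynomial (Fin d) k) P],
        ∀ f : (ExtMod (MvPolynomial (Fin d) k) j
            (ModuleCat.of _ (MvPolynomial (Fin d) k ⧸ I)) (ModuleCat.of _ (MvPolynomial (Fin d) k)))
            →ₛₗ[φ.toRingHom] P,
          ∃! h : (ExtMod (MvPolynomial (Fin d) k) j
              (ModuleCat.of _ (MvPolynomial (Fin d) k ⧸ Iq)) (ModuleCat.of _ (MvPolynomial (Fin d) k)))
              →ₗ[MvPolynomial (Fin d) k] P,
            ∀ x, h (g x) = f x := by
  classical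
  obtain rfl : φ = expand q := algHom_ext fun i => by rw [hφ, expand_X]
  have hq0 : 0 < q := Nat.zero_lt_of_lt hq
  let m : S → Fin d →₀ ℕ := Subtype.val
  rw [Set.image_eq_range] at hI hIq
  obtain ⟨π, hπ, hπ0⟩ := exists_ext_presentation m hI j
  obtain ⟨π', hπ', hπ0'⟩ := exists_ext_presentation (fun i => q • m i) hIq j
  refine ⟨exists_injective_of_presentation π hπ π' (taylorCoInclCocycle k m hq.le j) fun z => ?_,
    exists_semilinear_baseChange_of_presentation _
      (fun c : Fin d → Fin q => monomial (Finsupp.equivFunOnFinite.symm fun x => (c x : ℕ)) (1 : k))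
      (fun c => (expandCoeff q c).toAddMonoidHom) (sum_monomial_mul_expand_expandCoeff hq0)
      π hπ π' hπ' (expandCocycle k m q j) (fun z hz => ?_)
      (fun c => expandCoeffCocycle k m hq0 c j) (fun c z hz => ?_) (fun c r z => ?_) fun z => ?_⟩
  · rw [hπ0, hπ0']
    exact taylorCoIncl_mem_taylorCoboundaries_iff m (fun i => hS i i.2) hq.le
  · rw [hπ0']
    exact expand_mem_taylorCoboundaries m ((hπ0 z).1 hz)
  · rw [hπ0]
    exact expandCoeff_mem_taylorCoboundaries m hq0 c ((hπ0' z).1 hz)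
  · exact Subtype.ext (funext fun t => expandCoeff_mul_expand hq0 c r (z.1 t))
  · refine Subtype.ext (funext fun t => ?_)
    rw [AddSubmonoidClass.coe_finsetSum, Finset.sum_apply]
    exact sum_monomial_mul_expand_expandCoeff hq0 (z.1 t)
end

section
/- Let $R = K[x_1,\ldots,x_n]$ be a polynomial ring over a field $K$ of any characteristic and let $I$ be a (not necessarily squarefree) monomial ideal such that $R/I$ is Cohen-Macaulay. Then $\operatorname{H}^i_I(M) = 0$ for all $i > \operatorname{ht}(I)$ and all $R$-modules $M$. -/
open CategoryTheory Opposite MvPolynomial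

noncomputable def idealHeight (R : Type) [CommRing R] (I : Ideal R) : ℕ∞ :=
  sInf {n : ℕ∞ | ∃ p : PrimeSpectrum R, I ≤ p.asIdeal ∧ Order.height p = n}

/-- Depth of a module with respect to an ideal `𝔪`: the least `i` with
`Ext^i(R/𝔪, M) ≠ 0`. -/
noncomputable def depthWrt (R : Type) [CommRing R] (𝔪 : Ideal R) (M : ModuleCat R) : ℕ∞ :=
  sInf {n : ℕ∞ | ∃ i : ℕ, n = i ∧
    Nontrivial (ExtMod R i (ModuleCat.of R (R ⧸ 𝔪)) M)}

section ExtComparison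

variable {R : Type} [CommRing R] {M N : ModuleCat R}

open Abelian

lemma subsingleton_functorExt_succ (i : ℕ) [h : Subsingleton (Abelian.Ext M N (i + 1))] :
    Subsingleton (((_root_.Ext R (ModuleCat R) (i + 1)).obj (op M)).obj N) := by
  let P := ProjectiveResolution.of M
  refine ModuleCat.subsingleton_of_isZero (Limits.IsZero.of_iso ?_ (P.isoExt (R := R) (i + 1) N))
  rw [← HomologicalComplex.exactAt_iff_isZero_homology,
    HomologicalComplex.exactAt_iff' _ i (i + 1) (i + 2) (by simp) (by simp),
    ShortComplex.moduleCat_exact_iff]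
  intro (f : P.complex.X (i + 1) ⟶ N) hf
  have hf' : P.complex.d (i + 2) (i + 1) ≫ f = 0 := hf
  exact (P.extMk_eq_zero_iff f (i + 2) rfl hf' i rfl).1 (h.elim _ _)

lemma subsingleton_ext_of_functorExt (i : ℕ)
    (h : Subsingleton (((_root_.Ext R (ModuleCat R) i).obj (op M)).obj N)) :
    Subsingleton (Abelian.Ext M N i) := by
  let P := ProjectiveResolution.of M
  have hz := (ModuleCat.isZero_of_subsingleton
    (((_root_.Ext R (ModuleCat R) i).obj (op M)).obj N)).of_iso (P.isoExt (R := R) i N).symm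
  rw [← HomologicalComplex.exactAt_iff_isZero_homology] at hz
  refine subsingleton_of_forall_eq 0 fun α => ?_
  obtain ⟨f, hf, rfl⟩ := P.extMk_surjective α (i + 1) rfl
  cases i with
  | succ i =>
    rw [HomologicalComplex.exactAt_iff' _ i (i + 1) (i + 2) (by simp) (by simp),
      ShortComplex.moduleCat_exact_iff] at hz
    exact (P.extMk_eq_zero_iff f (i + 2) rfl hf i rfl).2 (hz f hf)
  | zero =>
    rw [HomologicalComplex.exactAt_iff' _ 0 0 1 (by simp) (by simp),
      ShortComplex.moduleCat_exact_iff] at hz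
    obtain ⟨(g : P.complex.X 0 ⟶ N), hg⟩ := hz f hf
    have h0 : (P.complex.linearYonedaObj R N).d 0 0 = 0 :=
      HomologicalComplex.shape _ _ _ (by simp)
    have : f = 0 := by
      rw [← hg]
      change (P.complex.linearYonedaObj R N).d 0 0 g = 0
      rw [h0]; rfl
    subst this
    simp

end ExtComparison

section Koszul

open Abelian

variable {R : Type} [CommRing R]

/-- The quotient `R ⧸ J` as an object of `ModuleCat R`. -/
noncomputable abbrev cyclicMod (J : Ideal R) : ModuleCat R := ModuleCat.of R (R ⧸ J)

/-- The morphism `R ⟶ N` sending `1` to `z`. -/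
noncomputable def pointHom {N : ModuleCat R} (z : N) : ModuleCat.of R R ⟶ N :=
  ModuleCat.ofHom (LinearMap.toSpanSingleton R N z)

lemma pointHom_apply_one {N : ModuleCat R} (φ : ModuleCat.of R R ⟶ N) :
    pointHom (φ (1 : R)) = φ := by
  ext
  simp [pointHom]

lemma pointHom_add {N : ModuleCat R} (y z : N) : pointHom (y + z) = pointHom y + pointHom z := by
  ext
  simp [pointHom]

lemma pointHom_smul {N : ModuleCat R} (r : R) (z : N) : pointHom (r • z) = r • pointHom z := by
  ext
  simp [pointHom]

lemma pointHom_comp {N P : ModuleCat R} (f : N ⟶ P) (z : N) :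
    pointHom z ≫ f = pointHom (f z) := by
  ext
  simp [pointHom]

lemma smul_ext_eq_mk₀_comp {M N : ModuleCat R} {j : ℕ} (e : Abelian.Ext M N j) (r : R) :
    r • e = (Ext.mk₀ (r • 𝟙 M)).comp e (zero_add j) := by
  rw [Ext.mk₀_smul, Ext.smul_comp, Ext.mk₀_id_comp]

lemma smul_ext_cyclicMod_eq_zero {J : Ideal R} {N : ModuleCat R} {j : ℕ}
    (e : Abelian.Ext (cyclicMod J) N j) {r : R} (hr : r ∈ J) : r • e = 0 := by
  have : r • 𝟙 (cyclicMod J) = 0 := by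
    ext
    simpa [Algebra.smul_def] using Ideal.Quotient.eq_zero_iff_mem.2 hr
  rw [smul_ext_eq_mk₀_comp, this, Ext.mk₀_zero, Ext.zero_comp]

lemma ext_comp_pointHom_eq_zero {J : Ideal R} {N : ModuleCat R} {j : ℕ}
    (θ : Abelian.Ext (cyclicMod J) (ModuleCat.of R R) j) {z : N}
    (hz : z ∈ J • (⊤ : Submodule R N)) :
    θ.comp (Ext.mk₀ (pointHom z)) (add_zero j) = 0 := by
  refine Submodule.smul_induction_on hz (fun r hr y _ => ?_) (fun y z hy hz => ?_)
  · rw [pointHom_smul, Ext.mk₀_smul, Ext.comp_smul, ← Ext.smul_comp,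
      smul_ext_cyclicMod_eq_zero θ hr, Ext.zero_comp]
  · rw [pointHom_add, Ext.mk₀_add, Ext.comp_add, hy, hz, add_zero]

/-- A class `θ ∈ Ext^j(R/J, R)` inducing isomorphisms `N/JN ≃ Ext^j(R/J, N)` for all `N`, where
moreover `R/J` has projective dimension at most `j`. -/
structure IsKoszulClass (J : Ideal R) (j : ℕ)
    (θ : Abelian.Ext (cyclicMod J) (ModuleCat.of R R) j) : Prop where
  hasProjectiveDimensionLT : HasProjectiveDimensionLT (cyclicMod J) (j + 1)
  exists_eq : ∀ (N : ModuleCat R) (e : Abelian.Ext (cyclicMod J) N j),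
    ∃ z : N, e = θ.comp (Ext.mk₀ (pointHom z)) (add_zero j)
  mem_of_comp_eq_zero : ∀ (N : ModuleCat R) (z : N),
    θ.comp (Ext.mk₀ (pointHom z)) (add_zero j) = 0 → z ∈ J • (⊤ : Submodule R N)

/-- The complex `R/J ⟶ R/J ⟶ R/(J + (x))` whose first map is multiplication by `x`. -/
noncomputable abbrev cyclicShortComplex (J : Ideal R) (x : R) : ShortComplex (ModuleCat R) :=
  ShortComplex.mk (x • 𝟙 (cyclicMod J))
    (ModuleCat.ofHom (Submodule.factor (le_sup_left : J ≤ J ⊔ Ideal.span {x})) :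
      cyclicMod J ⟶ cyclicMod (J ⊔ Ideal.span {x})) (by
    ext
    have : x * 1 ∈ J ⊔ Ideal.span {x} :=
      Ideal.mem_sup_right (Ideal.mul_mem_right _ _ (Ideal.mem_span_singleton_self x))
    exact (Submodule.Quotient.mk_eq_zero (J ⊔ Ideal.span {x})).2 this)

lemma cyclicShortComplex_shortExact {J : Ideal R} {x : R} (hx : ∀ a, x * a ∈ J → a ∈ J) :
    (cyclicShortComplex J x).ShortExact where
  mono_f := by
    rw [ModuleCat.mono_iff_injective, injective_iff_map_eq_zero]
    intro y hy
    obtain ⟨y, rfl⟩ := Ideal.Quotient.mk_surjective y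
    exact Ideal.Quotient.eq_zero_iff_mem.2 (hx y
      ((Submodule.Quotient.mk_eq_zero J (x := x * y)).1 hy))
  epi_g := by
    rw [ModuleCat.epi_iff_surjective]
    exact Submodule.factor_surjective le_sup_left
  exact := by
    rw [ShortComplex.moduleCat_exact_iff]
    intro y hy
    obtain ⟨y, rfl⟩ := Ideal.Quotient.mk_surjective y
    have hy' : y ∈ J ⊔ Ideal.span {x} := (Submodule.Quotient.mk_eq_zero _).1 hy
    obtain ⟨a, ha, b, hb, rfl⟩ := Submodule.mem_sup.1 hy'
    obtain ⟨c, rfl⟩ := Ideal.mem_span_singleton.1 hb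
    refine ⟨Ideal.Quotient.mk J c, ?_⟩
    change Ideal.Quotient.mk J (x * c) = Ideal.Quotient.mk J (a + x * c)
    simp [Ideal.Quotient.eq_zero_iff_mem.2 ha]

lemma IsKoszulClass.step {J : Ideal R} {j : ℕ}
    {θ : Abelian.Ext (cyclicMod J) (ModuleCat.of R R) j} (hθ : IsKoszulClass J j θ)
    {x : R} (hx : ∀ a, x * a ∈ J → a ∈ J) :
    IsKoszulClass (J ⊔ Ideal.span {x}) (j + 1)
      ((cyclicShortComplex_shortExact hx).extClass.comp θ (add_comm 1 j)) := by
  have hS := cyclicShortComplex_shortExact hx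
  have hpd := hθ.hasProjectiveDimensionLT
  refine ⟨hS.hasProjectiveDimensionLT_X₃ (j + 1) hpd
    (hasProjectiveDimensionLT_of_ge (cyclicMod J) (j + 1) _ (by omega)), fun N e => ?_,
    fun N z hz => ?_⟩
  · obtain ⟨e', he'⟩ := Ext.contravariant_sequence_exact₃ hS N e
      (Ext.eq_zero_of_hasProjectiveDimensionLT (X := cyclicMod J) _ (j + 1) le_rfl) (add_comm 1 j)
    obtain ⟨z, rfl⟩ := hθ.exists_eq N e'
    exact ⟨z, he'.symm.trans (Ext.comp_assoc_of_third_deg_zero _ _ _ _).symm⟩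
  · obtain ⟨e, he⟩ := Ext.contravariant_sequence_exact₁ hS N _ (add_comm 1 j)
      ((Ext.comp_assoc_of_third_deg_zero _ _ _ _).symm.trans hz)
    obtain ⟨y, hy⟩ := hθ.exists_eq N e
    have he' : x • e = θ.comp (Ext.mk₀ (pointHom z)) (add_zero j) := by
      rw [← he, smul_ext_eq_mk₀_comp]
    have h0 : θ.comp (Ext.mk₀ (pointHom (z + (-x) • y))) (add_zero j) = 0 := by
      rw [pointHom_add, Ext.mk₀_add, Ext.comp_add, ← he', hy, pointHom_smul, Ext.mk₀_smul,
        Ext.comp_smul, neg_smul, add_neg_cancel]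
    have h1 := Submodule.smul_mono_left (le_sup_left : J ≤ J ⊔ Ideal.span {x})
      (hθ.mem_of_comp_eq_zero N _ h0)
    have h2 : x • y ∈ (J ⊔ Ideal.span {x}) • (⊤ : Submodule R N) :=
      Submodule.smul_mem_smul (Ideal.mem_sup_right (Ideal.mem_span_singleton_self x)) trivial
    simpa using add_mem h1 h2

lemma IsKoszulClass.subsingleton_ext_sup {J : Ideal R} {j : ℕ}
    {θ : Abelian.Ext (cyclicMod J) (ModuleCat.of R R) j} (hθ : IsKoszulClass J j θ)
    {x : R} (hx : ∀ a, x * a ∈ J → a ∈ J) {N : ModuleCat R}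
    (hxN : ∀ z : N, x • z ∈ J • (⊤ : Submodule R N) → z ∈ J • (⊤ : Submodule R N))
    (hN : ∀ i < j, Subsingleton (Abelian.Ext (cyclicMod J) N i)) (i : ℕ) (hi : i < j + 1) :
    Subsingleton (Abelian.Ext (cyclicMod (J ⊔ Ideal.span {x})) N i) := by
  have hS := cyclicShortComplex_shortExact hx
  refine subsingleton_of_forall_eq 0 fun e => ?_
  have h0 : (Ext.mk₀ (cyclicShortComplex J x).g).comp e (zero_add i) = 0 := by
    obtain hi | rfl := Nat.lt_succ_iff_lt_or_eq.1 hi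
    · exact (hN i hi).elim _ _
    · set e' : Abelian.Ext (cyclicMod J) N i :=
        (Ext.mk₀ (cyclicShortComplex J x).g).comp e (zero_add i) with he'
      have h1 : x • e' = 0 := by
        rw [smul_ext_eq_mk₀_comp]
        change (Ext.mk₀ (cyclicShortComplex J x).f).comp e' _ = 0
        refine (Ext.comp_assoc_of_second_deg_zero _ _ _ _).symm.trans ?_
        rw [Ext.mk₀_comp_mk₀, (cyclicShortComplex J x).zero, Ext.mk₀_zero, Ext.zero_comp]
      obtain ⟨z, hz⟩ := hθ.exists_eq N e'
      rw [hz, ← Ext.comp_smul, ← Ext.mk₀_smul, ← pointHom_smul] at h1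
      rw [hz]
      exact ext_comp_pointHom_eq_zero θ (hxN z (hθ.mem_of_comp_eq_zero N _ h1))
  cases i with
  | zero =>
    have := hS.epi_g
    exact Ext.precomp_mk₀_injective_of_epi N (cyclicShortComplex J x).g (h0.trans (Ext.comp_zero _ _ _ _ (zero_add 0)).symm)
  | succ i =>
    obtain ⟨e', rfl⟩ := Ext.contravariant_sequence_exact₃ hS N e h0 (add_comm 1 i)
    have : e' = 0 := (hN i (by omega)).elim _ _
    rw [this]
    exact Ext.comp_zero _ _ _ _ _

lemma exists_isKoszulClass_bot : ∃ θ, IsKoszulClass (⊥ : Ideal R) 0 θ := by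
  let e : cyclicMod (⊥ : Ideal R) ≅ ModuleCat.of R R :=
    (Submodule.quotEquivOfEqBot (⊥ : Ideal R) rfl).toModuleIso
  refine ⟨Ext.mk₀ e.hom, ?_, fun N f => ?_, fun N z hz => ?_⟩
  · have : Projective (cyclicMod (⊥ : Ideal R)) := Projective.of_iso e.symm inferInstance
    exact projective_iff_hasProjectiveDimensionLT_one.1 this
  · obtain ⟨f, rfl⟩ := Ext.addEquiv₀.symm.surjective f
    refine ⟨(e.inv ≫ f) (1 : R), ?_⟩
    rw [pointHom_apply_one, Ext.mk₀_comp_mk₀, e.hom_inv_id_assoc]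
    rfl
  · rw [Ext.mk₀_comp_mk₀] at hz
    have h : e.hom ≫ pointHom z = 0 := Ext.addEquiv₀.symm.injective (by simpa using! hz)
    have h' : pointHom z = 0 := by rw [← cancel_epi e.hom, h, Limits.comp_zero]
    have : z = 0 := by
      have := ConcreteCategory.congr_hom h' (1 : R)
      simpa [pointHom] using! this
    simp [this]

end Koszul

section MinimalCovers

open Abelian

lemma IsKoszulClass.mem_smul_top_of_shortExact {R : Type} [CommRing R] {J : Ideal R} {n : ℕ}
    {θ : Abelian.Ext (cyclicMod J) (ModuleCat.of R R) n} (hθ : IsKoszulClass J n θ)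
    {S : ShortComplex (ModuleCat R)} (hS : S.ShortExact)
    (hJ : ∀ z : S.X₁, S.f z ∈ J • (⊤ : Submodule R S.X₂))
    (h₃ : ∀ i < n, Subsingleton (Abelian.Ext (cyclicMod J) S.X₃ i)) (z : S.X₁) :
    z ∈ J • (⊤ : Submodule R S.X₁) := by
  refine hθ.mem_of_comp_eq_zero _ z ?_
  have h0 : (θ.comp (Ext.mk₀ (pointHom z)) (add_zero n)).comp (Ext.mk₀ S.f) (add_zero n) = 0 := by
    rw [Ext.comp_assoc_of_third_deg_zero, Ext.mk₀_comp_mk₀, pointHom_comp]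
    exact ext_comp_pointHom_eq_zero θ (hJ z)
  cases n with
  | zero =>
    have := hS.mono_f
    exact Ext.postcomp_mk₀_injective_of_mono _ S.f (h0.trans (Ext.zero_comp _ _ _ _ (add_zero 0)).symm)
  | succ n =>
    obtain ⟨x, hx⟩ := Ext.covariant_sequence_exact₁ _ hS _ h0 rfl
    have : x = 0 := (h₃ n n.lt_succ_self).elim _ _
    rw [← hx, this, Ext.zero_comp]

lemma subsingleton_ext_X₁ {R : Type} [CommRing R] {M : ModuleCat R}
    {S : ShortComplex (ModuleCat R)} (hS : S.ShortExact) {n d : ℕ} (hd : d < n)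
    (h₂ : ∀ i < n, Subsingleton (Abelian.Ext M S.X₂ i))
    (h₃ : ∀ i < d, Subsingleton (Abelian.Ext M S.X₃ i)) (i : ℕ) (hi : i < d + 1) :
    Subsingleton (Abelian.Ext M S.X₁ i) := by
  refine subsingleton_of_forall_eq 0 fun e => ?_
  have h0 : e.comp (Ext.mk₀ S.f) (add_zero i) = 0 := (h₂ i (by omega)).elim _ _
  cases i with
  | zero =>
    have := hS.mono_f
    exact Ext.postcomp_mk₀_injective_of_mono _ S.f (h0.trans (Ext.zero_comp _ _ _ _ (add_zero 0)).symm)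
  | succ i =>
    obtain ⟨x, hx⟩ := Ext.covariant_sequence_exact₁ _ hS _ h0 rfl
    have : x = 0 := (h₃ i (by omega)).elim _ _
    rw [← hx, this, Ext.zero_comp]

lemma Finsupp.mem_ideal_smul_top_iff {R ι : Type} [CommRing R] {J : Ideal R} {z : ι →₀ R} :
    z ∈ J • (⊤ : Submodule R (ι →₀ R)) ↔ ∀ i, z i ∈ J := by
  refine ⟨fun hz i => ?_, fun h => ?_⟩
  · refine Submodule.smul_induction_on hz (fun r hr y _ => ?_) (fun y z hy hz => ?_)
    · exact J.mul_mem_right _ hr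
    · exact J.add_mem hy hz
  · rw [← z.sum_single]
    refine Submodule.sum_mem _ fun i _ => ?_
    have : Finsupp.single i (z i) = z i • Finsupp.single i (1 : R) := by simp
    rw [this]
    exact Submodule.smul_mem_smul (h i) trivial

end MinimalCovers

section Polynomial

open Abelian

variable {K : Type} [Field K] {σ : Type}

lemma X_mul_mem_span_X_image {A : Set σ} {i : σ} (hi : i ∉ A) {f : MvPolynomial σ K}
    (hf : X i * f ∈ Ideal.span (X '' A : Set (MvPolynomial σ K))) :
    f ∈ Ideal.span (X '' A : Set (MvPolynomial σ K)) := by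
  classical
  rw [mem_ideal_span_X_image] at hf ⊢
  intro m hm
  obtain ⟨j, hj, hj'⟩ := hf (Finsupp.single i 1 + m) (by
    rw [mem_support_iff, coeff_X_mul]
    exact mem_support_iff.1 hm)
  refine ⟨j, hj, ?_⟩
  have : i ≠ j := fun h => hi (h ▸ hj)
  simpa [Finsupp.single_apply, this] using hj'

lemma exists_isKoszulClass_span_X (A : Finset σ) :
    (∃ θ, IsKoszulClass (Ideal.span (X '' (A : Set σ) : Set (MvPolynomial σ K))) A.card θ) ∧
    ∀ (ι : Type) (i : ℕ), i < A.card →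
      Subsingleton (Abelian.Ext (cyclicMod (Ideal.span (X '' (A : Set σ) : Set (MvPolynomial σ K))))
        (ModuleCat.of _ (ι →₀ MvPolynomial σ K)) i) := by
  classical
  induction A using Finset.induction_on with
  | empty =>
    have : Ideal.span (X '' ((∅ : Finset σ) : Set σ) : Set (MvPolynomial σ K)) = ⊥ := by simp
    rw [this]
    exact ⟨exists_isKoszulClass_bot, fun ι i hi => absurd hi (by simp)⟩
  | insert a A ha ih =>
    obtain ⟨⟨θ, hθ⟩, ih⟩ := ih
    have : Ideal.span (X '' ((insert a A : Finset σ) : Set σ) : Set (MvPolynomial σ K)) =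
        Ideal.span (X '' (A : Set σ)) ⊔ Ideal.span {X a} := by
      rw [Finset.coe_insert, Set.image_insert_eq, Ideal.span_insert, sup_comm]
    have hx : ∀ f : MvPolynomial σ K, X a * f ∈ Ideal.span (X '' (A : Set σ)) →
      f ∈ Ideal.span (X '' (A : Set σ)) := fun f hf => X_mul_mem_span_X_image (by simpa using ha) hf
    rw [this, Finset.card_insert_of_notMem ha]
    refine ⟨⟨_, hθ.step hx⟩, fun ι i hi => hθ.subsingleton_ext_sup hx (fun z hz => ?_) (ih ι) i hi⟩
    rw [Finsupp.mem_ideal_smul_top_iff] at hz ⊢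
    exact fun j => hx _ (hz j)

end Polynomial

section Gradings

variable {K : Type} [Field K] {σ : Type}

/-- An `ℕ`-grading on a module over a polynomial ring with its standard grading, given by the
projections onto the graded pieces. -/
structure ModuleGrading (K σ N : Type) [Field K] [AddCommGroup N] [Module (MvPolynomial σ K) N] where
  proj : ℕ → N →+ N
  sum_proj : ∀ z, ∃ B, ∀ b ≥ B, ∑ k ∈ Finset.range b, proj k z = z
  proj_proj : ∀ l k z, proj l (proj k z) = if l = k then proj k z else 0
  proj_C_smul : ∀ k c z, proj k ((C c : MvPolynomial σ K) • z) = (C c : MvPolynomial σ K) • proj k z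
  proj_succ_X_smul : ∀ k i z,
    proj (k + 1) ((X i : MvPolynomial σ K) • z) = (X i : MvPolynomial σ K) • proj k z
  proj_zero_X_smul : ∀ i z, proj 0 ((X i : MvPolynomial σ K) • z) = 0

namespace ModuleGrading

variable {N : Type} [AddCommGroup N] [Module (MvPolynomial σ K) N]

lemma mem_of_forall_proj_mem (g : ModuleGrading K σ N) {P : Submodule (MvPolynomial σ K) N} {z : N}
    (h : ∀ k, g.proj k z ∈ P) : z ∈ P := by
  obtain ⟨B, hB⟩ := g.sum_proj z
  rw [← hB B le_rfl]
  exact P.sum_mem fun k _ => h k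

lemma eq_top_of_sup_eq_top (g : ModuleGrading K σ N) {P : Submodule (MvPolynomial σ K) N}
    (hP : ∀ k, ∀ z ∈ P, g.proj k z ∈ P)
    (h : P ⊔ Ideal.span (Set.range (X : σ → MvPolynomial σ K)) • ⊤ = ⊤) : P = ⊤ := by
  have key : ∀ k z, g.proj k z ∈ P := by
    intro k
    induction k with
    | zero =>
      intro z
      obtain ⟨p, hp, y, hy, rfl⟩ := Submodule.mem_sup.1 (h ▸ Submodule.mem_top : z ∈ _)
      rw [map_add]
      refine P.add_mem (hP _ _ hp) ?_
      refine Submodule.smul_induction_on hy (fun r hr y _ => ?_) (fun y z hy hz => ?_)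
      · revert y
        refine Submodule.span_induction ?_ ?_ ?_ ?_ hr
        · rintro _ ⟨i, rfl⟩ y _
          rw [g.proj_zero_X_smul]; exact P.zero_mem
        · simp
        · intro a b _ _ ha hb y _
          rw [add_smul, map_add]; exact P.add_mem (ha y trivial) (hb y trivial)
        · intro a b _ hb y _
          rw [smul_eq_mul, mul_comm, mul_smul]; exact hb _ trivial
      · rw [map_add]; exact P.add_mem hy hz
    | succ k ih =>
      intro z
      obtain ⟨p, hp, y, hy, rfl⟩ := Submodule.mem_sup.1 (h ▸ Submodule.mem_top : z ∈ _)
      rw [map_add]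
      refine P.add_mem (hP _ _ hp) ?_
      refine Submodule.smul_induction_on hy (fun r hr y _ => ?_) (fun y z hy hz => ?_)
      · revert y
        refine Submodule.span_induction ?_ ?_ ?_ ?_ hr
        · rintro _ ⟨i, rfl⟩ y _
          rw [g.proj_succ_X_smul]; exact P.smul_mem _ (ih y)
        · simp
        · intro a b _ _ ha hb y _
          rw [add_smul, map_add]; exact P.add_mem (ha y trivial) (hb y trivial)
        · intro a b _ hb y _
          rw [smul_eq_mul, mul_comm, mul_smul]; exact hb _ trivial
      · rw [map_add]; exact P.add_mem hy hz
  exact top_unique fun z _ => g.mem_of_forall_proj_mem fun k => key k z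

/-- The grading on a homogeneous submodule. -/
noncomputable def submodule (g : ModuleGrading K σ N) (P : Submodule (MvPolynomial σ K) N)
    (hP : ∀ k, ∀ z ∈ P, g.proj k z ∈ P) : ModuleGrading K σ P where
  proj k := AddMonoidHom.mk' (fun z => ⟨g.proj k z, hP k z z.2⟩) fun a b => by ext; simp
  sum_proj z := by
    obtain ⟨B, hB⟩ := g.sum_proj z
    exact ⟨B, fun b hb => by ext; simpa using hB b hb⟩
  proj_proj l k z := by
    ext; simp only [AddMonoidHom.mk'_apply, g.proj_proj]; split_ifs <;> simp
  proj_C_smul k c z := by ext; simpa using g.proj_C_smul k c z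
  proj_succ_X_smul k i z := by ext; simpa using g.proj_succ_X_smul k i z
  proj_zero_X_smul i z := by ext; simpa using g.proj_zero_X_smul i z

/-- The grading on the quotient by a homogeneous submodule. -/
noncomputable def quotient (g : ModuleGrading K σ N) (P : Submodule (MvPolynomial σ K) N)
    (hP : ∀ k, ∀ z ∈ P, g.proj k z ∈ P) : ModuleGrading K σ (N ⧸ P) where
  proj k := QuotientAddGroup.map P.toAddSubgroup P.toAddSubgroup (g.proj k) (hP k)
  sum_proj z := by
    obtain ⟨z, rfl⟩ := P.mkQ_surjective z
    obtain ⟨B, hB⟩ := g.sum_proj z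
    refine ⟨B, fun b hb => ?_⟩
    conv_rhs => rw [← hB b hb, map_sum]
    rfl
  proj_proj l k z := by
    obtain ⟨z, rfl⟩ := P.mkQ_surjective z
    refine (congrArg P.mkQ (g.proj_proj l k z)).trans ?_
    split_ifs
    · rfl
    · simp
  proj_C_smul k c z := by
    obtain ⟨z, rfl⟩ := P.mkQ_surjective z
    exact congrArg P.mkQ (g.proj_C_smul k c z)
  proj_succ_X_smul k i z := by
    obtain ⟨z, rfl⟩ := P.mkQ_surjective z
    exact congrArg P.mkQ (g.proj_succ_X_smul k i z)
  proj_zero_X_smul i z := by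
    obtain ⟨z, rfl⟩ := P.mkQ_surjective z
    exact congrArg P.mkQ (g.proj_zero_X_smul i z)

/-- The grading with all degrees raised by `w`. -/
noncomputable def shift (g : ModuleGrading K σ N) (w : ℕ) : ModuleGrading K σ N where
  proj k := if w ≤ k then g.proj (k - w) else 0
  sum_proj z := by
    obtain ⟨B, hB⟩ := g.sum_proj z
    refine ⟨B + w, fun b hb => ?_⟩
    obtain ⟨c, rfl⟩ : ∃ c, b = w + c := ⟨b - w, by omega⟩
    rw [Finset.sum_range_add, Finset.sum_eq_zero, zero_add]
    · simpa using hB c (by omega)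
    · intro k hk
      rw [if_neg (by simpa using hk)]; rfl
  proj_proj l k z := by
    by_cases hk : w ≤ k <;> by_cases hl : w ≤ l <;> simp only [hk, hl, if_true, if_false]
    · rw [g.proj_proj]
      congr 1
      exact propext ⟨fun h => by omega, fun h => by omega⟩
    · rw [if_neg (by omega)]; rfl
    · rw [if_neg (by omega)]; simp
    · simp
  proj_C_smul k c z := by
    split_ifs
    · exact g.proj_C_smul _ c z
    · simp
  proj_succ_X_smul k i z := by
    by_cases hk : w ≤ k
    · rw [if_pos hk, if_pos (by omega), Nat.succ_sub hk]
      exact g.proj_succ_X_smul _ i z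
    · rw [if_neg hk]
      split_ifs with h
      · rw [show k + 1 - w = 0 by omega, g.proj_zero_X_smul]; simp
      · simp
  proj_zero_X_smul i z := by
    split_ifs
    · rw [Nat.zero_sub]; exact g.proj_zero_X_smul i z
    · rfl

lemma proj_eq_ite (g : ModuleGrading K σ N) {s : N} {w : ℕ} (hs : g.proj w s = s) (k : ℕ) :
    g.proj k s = if k = w then s else 0 := by
  have := g.proj_proj k w s
  rwa [hs] at this

/-- The grading on finitely supported functions. -/
noncomputable def finsupp {ι : Type} (g : ι → ModuleGrading K σ N) : ModuleGrading K σ (ι →₀ N) where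
  proj k := Finsupp.liftAddHom fun j => (Finsupp.singleAddHom j).comp ((g j).proj k)
  sum_proj z := by
    induction z using Finsupp.induction_linear with
    | zero => exact ⟨0, by simp⟩
    | add y z hy hz =>
      obtain ⟨A, hA⟩ := hy
      obtain ⟨B, hB⟩ := hz
      refine ⟨max A B, fun b hb => ?_⟩
      simp only [map_add]
      rw [Finset.sum_add_distrib, hA b (le_trans (le_max_left _ _) hb),
        hB b (le_trans (le_max_right _ _) hb)]
    | single j z =>
      obtain ⟨B, hB⟩ := (g j).sum_proj z
      refine ⟨B, fun b hb => ?_⟩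
      conv_rhs => rw [← hB b hb]
      simp only [Finsupp.liftAddHom_apply_single, AddMonoidHom.comp_apply,
        Finsupp.singleAddHom_apply, Finsupp.single_finsetSum]
  proj_proj l k z := by
    induction z using Finsupp.induction_linear with
    | zero => simp
    | add y z hy hz => simp only [map_add, hy, hz]; split_ifs <;> simp
    | single j z =>
      simp only [Finsupp.liftAddHom_apply_single, AddMonoidHom.comp_apply,
        Finsupp.singleAddHom_apply, (g j).proj_proj]
      split_ifs <;> simp
  proj_C_smul k c z := by
    induction z using Finsupp.induction_linear with
    | zero => simp
    | add y z hy hz => simp only [map_add, smul_add, hy, hz]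
    | single j z =>
      simp only [Finsupp.smul_single, Finsupp.liftAddHom_apply_single, AddMonoidHom.comp_apply,
        Finsupp.singleAddHom_apply, (g j).proj_C_smul]
  proj_succ_X_smul k i z := by
    induction z using Finsupp.induction_linear with
    | zero => simp
    | add y z hy hz => simp only [map_add, smul_add, hy, hz]
    | single j z =>
      simp only [Finsupp.smul_single, Finsupp.liftAddHom_apply_single, AddMonoidHom.comp_apply,
        Finsupp.singleAddHom_apply, (g j).proj_succ_X_smul]
  proj_zero_X_smul i z := by
    induction z using Finsupp.induction_linear with
    | zero => simp
    | add y z hy hz => simp only [map_add, smul_add, hy, hz, add_zero]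
    | single j z =>
      simp only [Finsupp.smul_single, Finsupp.liftAddHom_apply_single, AddMonoidHom.comp_apply,
        Finsupp.singleAddHom_apply, (g j).proj_zero_X_smul, Finsupp.single_zero]

lemma finsupp_proj_single {ι : Type} (g : ι → ModuleGrading K σ N) (k : ℕ) (j : ι) (z : N) :
    (finsupp g).proj k (Finsupp.single j z) = Finsupp.single j ((g j).proj k z) := by
  simp only [finsupp, Finsupp.liftAddHom_apply_single, AddMonoidHom.comp_apply,
    Finsupp.singleAddHom_apply]

end ModuleGrading

variable (K σ) in
/-- The standard grading of a polynomial ring. -/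
noncomputable def polynomialGrading : ModuleGrading K σ (MvPolynomial σ K) where
  proj k := (homogeneousComponent k).toAddMonoidHom
  sum_proj z := ⟨z.totalDegree + 1, fun b hb => by
    rw [← Finset.sum_subset (Finset.range_subset_range.2 hb)]
    · exact sum_homogeneousComponent z
    · intro k _ hk
      exact homogeneousComponent_eq_zero _ _ (by simpa using hk)⟩
  proj_proj l k z := homogeneousComponent_of_mem (homogeneousComponent_mem k z)
  proj_C_smul k c z := homogeneousComponent_C_mul z k c
  proj_succ_X_smul k i z := by
    classical
    ext m
    simp only [LinearMap.toAddMonoidHom_coe, smul_eq_mul, coeff_homogeneousComponent,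
      coeff_X_mul']
    by_cases hm : i ∈ m.support
    · obtain ⟨m, rfl⟩ : ∃ m', m = m' + Finsupp.single i 1 :=
        ⟨m - Finsupp.single i 1, (tsub_add_cancel_of_le (by
          simpa [Nat.one_le_iff_ne_zero] using hm)).symm⟩
      simp
    · simp only [if_neg hm, ite_self]
  proj_zero_X_smul i z := by
    classical
    simp [coeff_X_mul']

lemma homogeneousComponent_monomial_mem {S : Set (σ →₀ ℕ)} (k : ℕ) :
    ∀ z ∈ Ideal.span ((fun a => monomial a (1 : K)) '' S),
      (polynomialGrading K σ).proj k z ∈ Ideal.span ((fun a => monomial a (1 : K)) '' S) := by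
  intro z hz
  rw [mem_ideal_span_monomial_image] at hz ⊢
  intro m hm
  refine hz m ?_
  rw [mem_support_iff] at hm ⊢
  intro h0
  apply hm
  change coeff m (homogeneousComponent k z) = 0
  rw [coeff_homogeneousComponent, h0, ite_self]

end Gradings

section GradedSyzygies

variable {K : Type} [Field K] {σ : Type}

lemma isMaximal_span_range_X :
    (Ideal.span (Set.range (X : σ → MvPolynomial σ K))).IsMaximal := by
  have : Ideal.span (Set.range (X : σ → MvPolynomial σ K)) = RingHom.ker constantCoeff := by
    ext f
    rw [← Set.image_univ, mem_ideal_span_X_image, RingHom.mem_ker, constantCoeff_eq]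
    refine ⟨fun h => ?_, fun h m hm => ?_⟩
    · by_contra h0
      obtain ⟨i, -, hi⟩ := h 0 (mem_support_iff.2 h0)
      exact hi rfl
    · obtain ⟨i, hi⟩ := DFunLike.ne_iff.1 (show m ≠ 0 from fun h0 =>
        mem_support_iff.1 hm (h0 ▸ h))
      exact ⟨i, trivial, hi⟩
  rw [this]
  exact RingHom.ker_isMaximal_of_surjective _ fun c => ⟨C c, constantCoeff_C _ _⟩

namespace ModuleGrading

variable {N : Type} [AddCommGroup N] [Module (MvPolynomial σ K) N]

lemma proj_smul_of_proj_one {w : ℕ} (g' : ModuleGrading K σ (MvPolynomial σ K))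
    (h1 : g'.proj w 1 = 1) (g : ModuleGrading K σ N) {s : N} (hs : g.proj w s = s) (k : ℕ)
    (p : MvPolynomial σ K) : g'.proj k p • s = g.proj k (p • s) := by
  induction p using MvPolynomial.induction_on generalizing k with
  | C c =>
    have := g'.proj_C_smul k c 1
    rw [smul_eq_mul, mul_one] at this
    rw [this, g.proj_C_smul, g'.proj_eq_ite h1, g.proj_eq_ite hs]
    split_ifs <;> simp
  | add p q hp hq => simp only [map_add, add_smul, hp, hq]
  | mul_X p i hp =>
    rw [mul_comm, ← smul_eq_mul, smul_assoc]
    cases k with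
    | zero => rw [g'.proj_zero_X_smul, g.proj_zero_X_smul, zero_smul]
    | succ k => rw [g'.proj_succ_X_smul, g.proj_succ_X_smul, smul_assoc, hp]

lemma exists_cover (g : ModuleGrading K σ N) :
    ∃ (ι : Type) (f : (ι →₀ MvPolynomial σ K) →ₗ[MvPolynomial σ K] N)
      (gF : ModuleGrading K σ (ι →₀ MvPolynomial σ K)), Function.Surjective f ∧
      (∀ k z, f (gF.proj k z) = g.proj k (f z)) ∧
      ∀ z, f z = 0 → z ∈ Ideal.span (Set.range (X : σ → MvPolynomial σ K)) •
        (⊤ : Submodule (MvPolynomial σ K) (ι →₀ MvPolynomial σ K)) := by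
  set m := Ideal.span (Set.range (X : σ → MvPolynomial σ K)) with hm
  have : m.IsMaximal := isMaximal_span_range_X
  let _ : Field (MvPolynomial σ K ⧸ m) := Ideal.Quotient.field m
  let V := N ⧸ (m • ⊤ : Submodule (MvPolynomial σ K) N)
  let q : N →ₗ[MvPolynomial σ K] V := Submodule.mkQ _
  have hsmul : ∀ r z, q (r • z) = (Ideal.Quotient.mk m r) • q z := fun r z => rfl
  obtain ⟨b, hbH, hspan, hli⟩ := exists_linearIndependent (MvPolynomial σ K ⧸ m)
    {v : V | ∃ s w, g.proj w s = s ∧ q s = v}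
  choose s w hs hq using fun j : b => hbH j.2
  let f := Finsupp.linearCombination (MvPolynomial σ K) s
  let gF := ModuleGrading.finsupp fun j => (polynomialGrading K σ).shift (w j)
  have hfg : ∀ k z, f (gF.proj k z) = g.proj k (f z) := by
    intro k z
    induction z using Finsupp.induction_linear with
    | zero => simp
    | add y z hy hz => simp only [map_add, hy, hz]
    | single j p =>
      simp only [gF, f, finsupp_proj_single, Finsupp.linearCombination_single]
      refine proj_smul_of_proj_one _ ?_ g (hs j) k p
      simp [shift, polynomialGrading]
  have hsurj : LinearMap.range f = ⊤ := by
    refine g.eq_top_of_sup_eq_top ?_ (top_unique fun z _ => ?_)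
    · rintro k _ ⟨z, rfl⟩
      exact ⟨_, hfg k z⟩
    · have hz : q z ∈ Submodule.span (MvPolynomial σ K ⧸ m) b := by
        rw [hspan]
        obtain ⟨B, hB⟩ := g.sum_proj z
        rw [← hB B le_rfl, map_sum]
        refine Submodule.sum_mem _ fun k _ => Submodule.subset_span ⟨_, k, ?_, rfl⟩
        rw [g.proj_proj, if_pos rfl]
      have : ∃ p, q (f p) = q z := by
        refine Submodule.span_induction (p := fun v _ => ∃ p, q (f p) = v) ?_ ?_ ?_ ?_ hz
        · intro v hv
          exact ⟨Finsupp.single ⟨v, hv⟩ 1, by simp [f, hq]⟩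
        · exact ⟨0, by simp⟩
        · rintro _ _ _ _ ⟨x, rfl⟩ ⟨y, rfl⟩
          exact ⟨x + y, by simp⟩
        · rintro a _ _ ⟨x, rfl⟩
          obtain ⟨a, rfl⟩ := Ideal.Quotient.mk_surjective a
          exact ⟨a • x, by rw [map_smul, hsmul]⟩
      obtain ⟨p, hp⟩ := this
      rw [← sub_add_cancel z (f p), add_comm]
      refine Submodule.add_mem_sup ⟨p, rfl⟩ ((Submodule.Quotient.eq _).1 hp.symm)
  refine ⟨b, f, gF, LinearMap.range_eq_top.1 hsurj, hfg, fun z hz => ?_⟩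
  rw [Finsupp.mem_ideal_smul_top_iff]
  intro j
  rw [← Ideal.Quotient.eq_zero_iff_mem]
  have := linearIndependent_iff.1 hli
    (z.mapRange (Ideal.Quotient.mk m) (map_zero _)) ?_
  · exact DFunLike.congr_fun this j
  · have h0 : q (f z) = 0 := by rw [hz, map_zero]
    rw [← h0, Finsupp.linearCombination_apply, Finsupp.linearCombination_apply,
      Finsupp.sum_mapRange_index (by simp), Finsupp.sum, Finsupp.sum, map_sum]
    exact Finset.sum_congr rfl fun i _ => by rw [hsmul, hq]

/-- A graded form of the Auslander-Buchsbaum formula over a polynomial ring. -/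
theorem hasProjectiveDimensionLT_of_subsingleton_ext [Fintype σ] (p d : ℕ)
    (hd : d + p = Fintype.card σ) (g : ModuleGrading K σ N)
    (h : ∀ i < d, Subsingleton (Abelian.Ext
      (cyclicMod (Ideal.span (Set.range (X : σ → MvPolynomial σ K)))) (ModuleCat.of _ N) i)) :
    HasProjectiveDimensionLT (ModuleCat.of (MvPolynomial σ K) N) (p + 1) := by
  have hm : (Set.range (X : σ → MvPolynomial σ K)) = X '' ((Finset.univ : Finset σ) : Set σ) := by
    simp
  obtain ⟨⟨θ, hθ⟩, hfree⟩ := exists_isKoszulClass_span_X (K := K) (Finset.univ : Finset σ)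
  rw [← hm] at hfree
  obtain ⟨θ, hθ⟩ : ∃ θ, IsKoszulClass (Ideal.span (Set.range (X : σ → MvPolynomial σ K)))
      (Finset.univ : Finset σ).card θ := by
    rw [hm]; exact ⟨θ, hθ⟩
  rw [Finset.card_univ] at hfree
  induction p generalizing d N with
  | zero =>
    obtain ⟨ι, f, gF, hsurj, hcomm, hker⟩ := g.exists_cover
    have hS := LinearMap.shortExact_shortComplexKer hsurj
    have hP : Projective f.shortComplexKer.X₂ :=
      (IsProjective.iff_projective _).1 (inferInstanceAs (Module.Projective _ (ι →₀ MvPolynomial σ K)))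
    refine hS.hasProjectiveDimensionLT_X₃ 0 ?_ inferInstance
    refine Limits.IsZero.hasProjectiveDimensionLT_zero
      (ModuleCat.isZero_of_iff_subsingleton.2 ?_)
    let gK := gF.submodule (LinearMap.ker f) fun k z hz => by
      rw [LinearMap.mem_ker] at hz ⊢
      rw [hcomm, hz, map_zero]
    have := gK.eq_top_of_sup_eq_top (P := ⊥) (fun k z hz => by
      rw [(Submodule.mem_bot _).1 hz, map_zero]; exact Submodule.zero_mem _) (by
      rw [bot_sup_eq]
      refine top_unique fun z _ => hθ.mem_smul_top_of_shortExact hS (fun z => hker _ z.2)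
        (fun i hi => h i ?_) z
      rwa [Finset.card_univ, ← hd] at hi)
    exact (Submodule.subsingleton_iff _).1 (subsingleton_of_bot_eq_top this)
  | succ p ih =>
    obtain ⟨ι, f, gF, hsurj, hcomm, hker⟩ := g.exists_cover
    have hS := LinearMap.shortExact_shortComplexKer hsurj
    have hP : Projective f.shortComplexKer.X₂ :=
      (IsProjective.iff_projective _).1 (inferInstanceAs (Module.Projective _ (ι →₀ MvPolynomial σ K)))
    refine hS.hasProjectiveDimensionLT_X₃ (p + 1) ?_ inferInstance
    let gK := gF.submodule (LinearMap.ker f) fun k z hz => by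
      rw [LinearMap.mem_ker] at hz ⊢
      rw [hcomm, hz, map_zero]
    exact ih (d + 1) (by omega) gK (subsingleton_ext_X₁ hS (by omega) (hfree ι) h)

end ModuleGrading

end GradedSyzygies

section BaseChange

lemma CategoryTheory.Functor.hasProjectiveDimensionLT_obj {C D : Type*} [Category C] [Abelian C]
    [EnoughProjectives C] [Category D] [Abelian D] (F : C ⥤ D) [Limits.PreservesFiniteLimits F]
    [Limits.PreservesFiniteColimits F] [F.PreservesProjectiveObjects] (n : ℕ) (M : C)
    [hM : HasProjectiveDimensionLT M (n + 1)] : HasProjectiveDimensionLT (F.obj M) (n + 1) := by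
  induction n generalizing M with
  | zero =>
    have : Projective M := projective_iff_hasProjectiveDimensionLT_one.2 hM
    have : Projective (F.obj M) := F.projective_obj M
    infer_instance
  | succ n ih =>
    have := F.additive_of_preserves_binary_products
    obtain ⟨⟨P, f⟩⟩ := EnoughProjectives.presentation M
    let T := ShortComplex.mk (Limits.kernel.ι f) f (Limits.kernel.condition f)
    have hT : T.ShortExact := { exact := ShortComplex.exact_kernel f }
    have hTF := hT.map_of_exact F
    have : Projective (T.map F).X₂ := F.projective_obj P
    have := (hT.hasProjectiveDimensionLT_X₃_iff n ‹_›).mp hM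
    exact (hTF.hasProjectiveDimensionLT_X₃_iff n ‹_›).mpr (ih (Limits.kernel f))

variable {A B : Type} [CommRing A] [CommRing B]

lemma RingHom.Flat.hasProjectiveDimensionLT_cyclicMod_map {φ : A →+* B} (hφ : φ.Flat) (I : Ideal A)
    (n : ℕ) [HasProjectiveDimensionLT (cyclicMod I) (n + 1)] :
    HasProjectiveDimensionLT (cyclicMod (I.map φ)) (n + 1) := by
  have := ModuleCat.preservesFiniteLimits_extendScalars_of_flat hφ
  have : (ModuleCat.extendScalars.{_, _, 0} φ).PreservesProjectiveObjects :=
    ⟨fun {P} hP => (ModuleCat.extendRestrictScalarsAdj φ).map_projective P hP⟩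
  have : Limits.PreservesFiniteColimits (ModuleCat.extendScalars.{_, _, 0} φ) := by
    have := (ModuleCat.extendRestrictScalarsAdj.{_, _, 0} φ).leftAdjoint_preservesColimits
    infer_instance
  have := (ModuleCat.extendScalars.{_, _, 0} φ).hasProjectiveDimensionLT_obj n (cyclicMod I)
  let _ := φ.toAlgebra
  let e : (ModuleCat.extendScalars.{_, _, 0} φ).obj (cyclicMod I) ≅ cyclicMod (I.map φ) :=
    (LinearEquiv.toModuleIso
      (Algebra.TensorProduct.quotIdealMapEquivTensorQuot B I).toLinearEquiv).symm
  exact hasProjectiveDimensionLT_of_iso e (n + 1)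

lemma RingHom.flat_of_bijective_sum {φ : A →+* B} {E : Type} (b : E → B)
    (hb : Function.Bijective fun p : E →₀ A => p.sum fun e a => φ a * b e) : φ.Flat := by
  algebraize [φ]
  let Φ : (E →₀ A) →ₗ[A] B := Finsupp.linearCombination A b
  have hΦ : Function.Bijective Φ := by
    convert hb using 1
    ext p
    simp [Φ, Finsupp.linearCombination_apply, Algebra.smul_def, RingHom.algebraMap_toAlgebra]
  exact Module.Flat.of_linearEquiv (LinearEquiv.ofBijective Φ hΦ).symm

lemma MvPolynomial.expand_flat {K σ : Type} [CommRing K] {t : ℕ} (ht : 0 < t) :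
    (expand t : MvPolynomial σ K →ₐ[K] MvPolynomial σ K).toRingHom.Flat := by
  classical
  let E := {e : σ →₀ ℕ // ∀ i, e i < t}
  let ε : (Σ _ : E, σ →₀ ℕ) → (σ →₀ ℕ) := fun x => t • x.2 + x.1.1
  have hε : Function.Bijective ε := by
    constructor
    · rintro ⟨⟨e, he⟩, a⟩ ⟨⟨f, hf⟩, b⟩ h
      have h1 : ∀ i, t * a i + e i = t * b i + f i := fun i => by
        simpa [ε] using DFunLike.congr_fun h i
      have hef : e = f := by
        ext i
        have := congrArg (· % t) (h1 i)
        simpa [Nat.mul_add_mod, Nat.mod_eq_of_lt (he i), Nat.mod_eq_of_lt (hf i)] using this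
      subst hef
      have hab : a = b := by
        ext i
        have := h1 i
        exact Nat.eq_of_mul_eq_mul_left ht (by omega)
      subst hab
      rfl
    · intro m
      refine ⟨⟨⟨m.mapRange (· % t) (Nat.zero_mod t), fun i => ?_⟩,
        m.mapRange (· / t) (Nat.zero_div t)⟩, ?_⟩
      · simpa using Nat.mod_lt _ ht
      · ext i
        simpa [ε] using Nat.div_add_mod (m i) t
  let b : E → MvPolynomial σ K := fun e => monomial e.1 1
  let Φ : (E →₀ MvPolynomial σ K) →ₗ[K] MvPolynomial σ K :=
    Finsupp.lsum K fun e => (LinearMap.mulRight K (b e)).comp (expand t).toLinearMap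
  let Ψ := (Finsupp.basis fun _ : E => basisMonomials σ K).equiv (basisMonomials σ K)
    (Equiv.ofBijective ε hε)
  have hΦ : Φ = Ψ.toLinearMap := by
    refine (Finsupp.basis fun _ : E => basisMonomials σ K).ext fun x => ?_
    rw [LinearEquiv.coe_coe, Module.Basis.equiv_apply]
    simp [Φ, b, ε, expand_monomial, monomial_mul]
  refine RingHom.flat_of_bijective_sum b ?_
  have : Function.Bijective Φ := by
    rw [hΦ]; exact Ψ.bijective
  exact this

end BaseChange

section Colimit

lemma subsingleton_colimit_obj {R : Type} [CommRing R] {D : Type} [SmallCategory D]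
    (F : D ⥤ ModuleCat.{0} R ⥤ ModuleCat.{0} R) (M : ModuleCat.{0} R)
    (h : ∀ j, ∃ (j' : D) (f : j ⟶ j'), (F.map f).app M = 0) :
    Subsingleton ((Limits.colimit F).obj M) := by
  refine ModuleCat.subsingleton_of_isZero
    (Limits.IsZero.of_iso ?_ (Limits.colimitObjIsoColimitCompEvaluation F M))
  rw [Limits.IsZero.iff_id_eq_zero]
  refine Limits.colimit.hom_ext fun j => ?_
  obtain ⟨j', f, hf⟩ := h j
  rw [← Limits.colimit.w _ f]
  simp [hf]

lemma functorExt_map_comp_app_eq_zero {R : Type} [CommRing R] (i : ℕ) (M : ModuleCat.{0} R)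
    {P Q T : ModuleCat.{0} R} (b : P ⟶ Q) (c : Q ⟶ T)
    [Subsingleton (((_root_.Ext R (ModuleCat R) i).obj (op Q)).obj M)] :
    ((_root_.Ext R (ModuleCat R) i).map (b ≫ c).op).app M = 0 := by
  rw [op_comp, Functor.map_comp, NatTrans.comp_app, (ModuleCat.isZero_of_subsingleton _).eq_of_tgt
    (((_root_.Ext R (ModuleCat R) i).map c.op).app M) 0, Limits.zero_comp]

lemma subsingleton_localCohomology_obj {R : Type} [CommRing R] (I : Ideal R) (i : ℕ)
    (M : ModuleCat.{0} R)
    (h : ∀ t, ∃ J ≤ I ^ t, (∃ s, I ^ s ≤ J) ∧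
      Subsingleton (((_root_.Ext R (ModuleCat R) i).obj (op (cyclicMod J))).obj M)) :
    Subsingleton ((localCohomology I i).obj M) := by
  refine subsingleton_colimit_obj _ M fun j => ?_
  obtain ⟨J, hJ, ⟨s, hs⟩, hE⟩ := h j.unop.unop
  have hsJ : I ^ (j.unop.unop + s) ≤ J := (Ideal.pow_le_pow_right (Nat.le_add_left _ _)).trans hs
  refine ⟨op (op (j.unop.unop + s)),
    (homOfLE (Nat.le_add_right j.unop.unop s)).op.op, ?_⟩
  let b : cyclicMod (I ^ (j.unop.unop + s)) ⟶ cyclicMod J :=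
    ModuleCat.ofHom (Submodule.mapQ _ _ LinearMap.id hsJ)
  let c : cyclicMod J ⟶ cyclicMod (I ^ j.unop.unop) :=
    ModuleCat.ofHom (Submodule.mapQ _ _ LinearMap.id hJ)
  have hbc : (localCohomology.ringModIdeals (localCohomology.idealPowersDiagram I)).map
      (homOfLE (Nat.le_add_right j.unop.unop s)).op = b ≫ c := by
    refine ModuleCat.hom_ext (LinearMap.ext fun x => ?_)
    obtain ⟨x, rfl⟩ := Submodule.mkQ_surjective (I ^ (j.unop.unop + s)) x
    rfl
  exact (congrArg (fun a => ((_root_.Ext R (ModuleCat R) i).map (Quiver.Hom.op a)).app M) hbc).trans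
    (functorExt_map_comp_app_eq_zero i M b c)

end Colimit

section FrobeniusPowers

variable {K : Type} [Field K]

lemma map_expand_le_pow {σ : Type} {S : Set (σ →₀ ℕ)} (t : ℕ) :
    (Ideal.span ((fun a => monomial a (1 : K)) '' S)).map
      (expand t : MvPolynomial σ K →ₐ[K] MvPolynomial σ K).toRingHom ≤
        Ideal.span ((fun a => monomial a (1 : K)) '' S) ^ t := by
  rw [Ideal.map_span, Ideal.span_le]
  rintro _ ⟨_, ⟨a, ha, rfl⟩, rfl⟩
  have : (expand t).toRingHom (monomial a (1 : K)) = monomial a (1 : K) ^ t := by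
    simp [expand_monomial, monomial_pow]
  rw [this]
  exact Ideal.pow_mem_pow (Ideal.subset_span (Set.mem_image_of_mem _ ha)) t

lemma exists_pow_le_map_expand {σ : Type} [Finite σ] {S : Set (σ →₀ ℕ)} (t : ℕ) :
    ∃ s, Ideal.span ((fun a => monomial a (1 : K)) '' S) ^ s ≤
      (Ideal.span ((fun a => monomial a (1 : K)) '' S)).map
        (expand t : MvPolynomial σ K →ₐ[K] MvPolynomial σ K).toRingHom := by
  refine Ideal.exists_pow_le_of_le_radical_of_fg ?_ (IsNoetherian.noetherian _)
  rw [Ideal.span_le]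
  rintro _ ⟨a, ha, rfl⟩
  refine Ideal.mem_radical_iff.2 ⟨t, ?_⟩
  have : monomial a (1 : K) ^ t = (expand t).toRingHom (monomial a (1 : K)) := by
    simp [expand_monomial, monomial_pow]
  rw [this]
  exact Ideal.mem_map_of_mem _ (Ideal.subset_span ⟨a, ha, rfl⟩)

theorem subsingleton_localCohomology_of_hasProjectiveDimensionLT {σ : Type} [Finite σ]
    {S : Set (σ →₀ ℕ)} {I : Ideal (MvPolynomial σ K)}
    (hI : I = Ideal.span ((fun a => monomial a (1 : K)) '' S)) (i : ℕ)
    [HasProjectiveDimensionLT (cyclicMod I) (i + 1)] (M : ModuleCat (MvPolynomial σ K)) :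
    Subsingleton ((localCohomology I (i + 1)).obj M) := by
  refine subsingleton_localCohomology_obj I (i + 1) M fun t => ⟨I.map (expand (t + 1) :
    MvPolynomial σ K →ₐ[K] MvPolynomial σ K).toRingHom, ?_, ?_, ?_⟩
  · refine le_trans ?_ (Ideal.pow_le_pow_right t.le_succ)
    rw [hI]
    exact map_expand_le_pow _
  · rw [hI]
    exact exists_pow_le_map_expand _
  · have := (expand_flat (K := K) (σ := σ) t.succ_pos).hasProjectiveDimensionLT_cyclicMod_map I i
    have := HasProjectiveDimensionLT.subsingleton (cyclicMod (I.map (expand (t + 1) :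
      MvPolynomial σ K →ₐ[K] MvPolynomial σ K).toRingHom)) (i + 1) (i + 1) le_rfl M
    exact subsingleton_functorExt_succ i

end FrobeniusPowers

section Dimension

variable {K : Type} [Field K] {σ : Type}

lemma isPrime_span_X_image (A : Set σ) :
    (Ideal.span (X '' A : Set (MvPolynomial σ K))).IsPrime := by
  classical
  let P : Ideal (MvPolynomial σ K) := Ideal.span (X '' A)
  let ψ : MvPolynomial σ K →ₐ[K] MvPolynomial σ K := aeval fun j => if j ∈ A then 0 else X j
  have hψ : (Ideal.Quotient.mkₐ K P).comp ψ = Ideal.Quotient.mkₐ K P := by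
    refine algHom_ext fun j => ?_
    by_cases hj : j ∈ A
    · have : Ideal.Quotient.mk P (X j) = 0 :=
        Ideal.Quotient.eq_zero_iff_mem.2 (Ideal.subset_span (Set.mem_image_of_mem _ hj))
      simp [ψ, hj, this]
    · simp [ψ, hj]
  have hP : P = RingHom.ker ψ := by
    refine le_antisymm (Ideal.span_le.2 ?_) fun f hf => ?_
    · rintro _ ⟨j, hj, rfl⟩
      simp [ψ, RingHom.mem_ker, hj]
    · have := DFunLike.congr_fun hψ f
      rw [AlgHom.comp_apply, RingHom.mem_ker.1 hf, map_zero] at this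
      exact Ideal.Quotient.eq_zero_iff_mem.1 this.symm
  change P.IsPrime
  rw [hP]
  exact RingHom.ker_isPrime _

lemma card_le_height_span_X (A : Finset σ) :
    (A.card : ℕ∞) ≤ Order.height (⟨Ideal.span (X '' (A : Set σ)), isPrime_span_X_image _⟩ :
      PrimeSpectrum (MvPolynomial σ K)) := by
  classical
  induction A using Finset.induction_on with
  | empty => simp
  | insert a A ha ih =>
    rw [Finset.card_insert_of_notMem ha, Nat.cast_add, Nat.cast_one]
    refine (add_le_add_left ih 1).trans (Order.height_add_one_le (lt_of_le_of_ne ?_ fun h => ?_))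
    · exact Ideal.span_mono (Set.image_mono (by simp))
    · have h' := congrArg PrimeSpectrum.asIdeal h
      have hX : (X a : MvPolynomial σ K) ∈ Ideal.span (X '' (A : Set σ)) := by
        change _ = Ideal.span (X '' ((insert a A : Finset σ) : Set σ)) at h'
        rw [show Ideal.span (X '' (A : Set σ)) = _ from h']
        exact Ideal.subset_span (Set.mem_image_of_mem _ (by simp))
      rw [mem_ideal_span_X_image] at hX
      obtain ⟨j, hj, hj'⟩ := hX (Finsupp.single a 1) (by simp)
      rw [Finsupp.single_apply_ne_zero] at hj'
      exact ha (hj'.1 ▸ hj)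

lemma le_ringKrullDim_quotient_monomial [Fintype σ] {S : Set (σ →₀ ℕ)} (A : Finset σ)
    (hA : ∀ a ∈ S, ∃ j ∈ A, a j ≠ 0) :
    ((Fintype.card σ - A.card : ℕ) : WithBot ℕ∞) ≤ ringKrullDim
      (MvPolynomial σ K ⧸ Ideal.span ((fun a => monomial a (1 : K)) '' S)) := by
  classical
  let ψ : MvPolynomial σ K →ₐ[K] MvPolynomial {j // j ∉ A} K :=
    aeval fun j => if h : j ∈ A then 0 else X ⟨j, h⟩
  have hψ : Function.Surjective ψ := by
    intro f
    refine ⟨rename (↑) f, ?_⟩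
    have : ψ.comp (rename (↑)) = AlgHom.id K (MvPolynomial {j // j ∉ A} K) :=
      algHom_ext fun j => by simp [ψ, j.2]
    exact DFunLike.congr_fun this f
  have hker : ∀ f ∈ Ideal.span ((fun a => monomial a (1 : K)) '' S), ψ.toRingHom f = 0 := by
    intro f hf
    rw [← RingHom.mem_ker]
    refine (Ideal.span_le (I := RingHom.ker ψ.toRingHom)).2 ?_ hf
    rintro _ ⟨a, ha, rfl⟩
    obtain ⟨j, hj, hj'⟩ := hA a ha
    change ψ (monomial a 1) = 0
    simp only [ψ, aeval_monomial, map_one, one_mul]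
    exact Finset.prod_eq_zero (Finsupp.mem_support_iff.2 hj') (by simp [hj, hj'])
  have h1 := ringKrullDim_le_of_surjective (Ideal.Quotient.lift _ ψ.toRingHom hker)
    (Ideal.Quotient.lift_surjective_of_surjective _ _ hψ)
  refine le_trans ?_ h1
  have h2 := ringKrullDim_add_natCard_le_ringKrullDim_mvPolynomial (R := K) {j // j ∉ A}
  rw [ringKrullDim_eq_zero_of_field, zero_add, Nat.card_eq_fintype_card,
    Fintype.card_subtype_compl, Fintype.card_coe] at h2
  exact h2

lemma exists_variable_cover_of_idealHeight_lt [Fintype σ] {S : Set (σ →₀ ℕ)} {i : ℕ}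
    (h : idealHeight (MvPolynomial σ K) (Ideal.span ((fun a => monomial a (1 : K)) '' S)) < i) :
    ∃ A : Finset σ, A.card < i ∧ ∀ a ∈ S, ∃ j ∈ A, a j ≠ 0 := by
  classical
  obtain ⟨_, ⟨p, hp, rfl⟩, hi⟩ := sInf_lt_iff.1 h
  let A : Finset σ := Finset.univ.filter fun j => (X j : MvPolynomial σ K) ∈ p.asIdeal
  refine ⟨A, ?_, fun a ha => ?_⟩
  · have : (⟨Ideal.span (X '' (A : Set σ)), isPrime_span_X_image _⟩ :
        PrimeSpectrum (MvPolynomial σ K)) ≤ p := by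
      refine Ideal.span_le.2 ?_
      rintro _ ⟨j, hj, rfl⟩
      exact (Finset.mem_filter.1 hj).2
    exact_mod_cast (card_le_height_span_X A).trans_lt ((Order.height_mono this).trans_lt hi)
  · have hm : monomial a (1 : K) ∈ p.asIdeal :=
      hp (Ideal.subset_span (Set.mem_image_of_mem _ ha))
    rw [monomial_eq, C_1, one_mul, Finsupp.prod, p.2.prod_mem_iff] at hm
    obtain ⟨j, hj, hj'⟩ := hm
    exact ⟨j, Finset.mem_filter.2 ⟨Finset.mem_univ _, p.2.mem_of_pow_mem _ hj'⟩,
      Finsupp.mem_support_iff.1 hj⟩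

end Dimension

lemma subsingleton_extMod_of_lt_depthWrt {R : Type} [CommRing R] {𝔪 : Ideal R} {M : ModuleCat R}
    {i : ℕ} (h : (i : ℕ∞) < depthWrt R 𝔪 M) :
    Subsingleton (ExtMod R i (ModuleCat.of R (R ⧸ 𝔪)) M) := by
  rw [← not_nontrivial_iff_subsingleton]
  exact fun hn => absurd h (not_lt.2 (sInf_le ⟨i, rfl, hn⟩))

/-- If `I` is a monomial ideal of `R = K[x₁,…,xₙ]` with `R/I` Cohen-Macaulay, then
`H^i_I(M) = 0` for all `i > ht I` and every `R`-module `M`. -/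
theorem localCohomology_monomial_cohenMacaulay_vanish
    (K : Type) [Field K] (n : ℕ)
    (S : Set (Fin n →₀ ℕ)) (I : Ideal (MvPolynomial (Fin n) K))
    (hI : I = Ideal.span ((fun a => monomial a (1 : K)) '' S))
    (𝔪 : Ideal (MvPolynomial (Fin n) K))
    (h𝔪 : 𝔪 = Ideal.span (Set.range (X : Fin n → MvPolynomial (Fin n) K)))
    (hCM : (depthWrt (MvPolynomial (Fin n) K) 𝔪
        (ModuleCat.of _ (MvPolynomial (Fin n) K ⧸ I)) : WithBot ℕ∞) =
      ringKrullDim (MvPolynomial (Fin n) K ⧸ I)) :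
    ∀ (M : ModuleCat (MvPolynomial (Fin n) K)) (i : ℕ),
      idealHeight (MvPolynomial (Fin n) K) I < (i : ℕ∞) →
        Subsingleton ((localCohomology I i).obj M) := by
  subst hI h𝔪
  intro M i hi
  obtain ⟨A, hAi, hA⟩ := exists_variable_cover_of_idealHeight_lt hi
  obtain ⟨i, rfl⟩ : ∃ k, i = k + 1 := ⟨i - 1, by omega⟩
  have hcard : A.card ≤ n := by simpa using A.card_le_univ
  have hdepth := le_ringKrullDim_quotient_monomial (K := K) A hA
  rw [← hCM, Fintype.card_fin] at hdepth
  replace hdepth := WithBot.coe_le_coe.1 hdepth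
  have hpd := ModuleGrading.hasProjectiveDimensionLT_of_subsingleton_ext A.card (n - A.card)
    (by rw [Fintype.card_fin]; omega)
    ((polynomialGrading K (Fin n)).quotient _ (homogeneousComponent_monomial_mem (S := S)))
    fun j hj => subsingleton_ext_of_functorExt j
      (subsingleton_extMod_of_lt_depthWrt ((Nat.cast_lt.2 hj).trans_le hdepth))
  have := hasProjectiveDimensionLT_of_ge (cyclicMod (Ideal.span ((fun a => monomial a (1 : K)) '' S)))
    (A.card + 1) (i + 1) hAi
  exact subsingleton_localCohomology_of_hasProjectiveDimensionLT rfl i M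
end
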